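/- Let k ≥ 17 and let S be a k-vertex tree with a hub v_S such that either v_S is adjacent to at most one leaf, or v_S is the root of at least three major branches and at most one fork. If T is a tree with radius at least 4k, then d(S,T) ≤ 1 - 10^{-7}. -/

import Mathlib

open SimpleGraph Filter

/-- The degree of a vertex, as the cardinality of its neighbour set. -/
noncomputable def ndeg {V : Type*} (G : SimpleGraph V) (v : V) : ℕ :=
  (G.neighborSet v).ncard

/-- `Z_k(G)`: the number of `k`-vertex subtrees (connected subgraphs) of `G`. -/
noncomputable def subtreeCount {V : Type*} [Fintype V] (G : SimpleGraph V) (k : ℕ) : ℕ :=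
  {s : Finset V | s.card = k ∧ (G.induce (s : Set V)).Connected}.ncard

/-- The number of embeddings (subtrees isomorphic to `S`) of a tree `S` in `G`,
counted among `k`-vertex subtrees. -/
noncomputable def embCount {V W : Type*} [Fintype V] (G : SimpleGraph V)
    (S : SimpleGraph W) (k : ℕ) : ℕ :=
  {s : Finset V | s.card = k ∧ Nonempty ((G.induce (s : Set V)) ≃g S)}.ncard

/-- The density `d(S,T)`: the number of embeddings of the `|S|`-vertex tree `S` in `T`
divided by the number of `|S|`-vertex subtrees of `T` (`0` if `T` has fewer vertices). -/
noncomputable def density {V W : Type*} [Fintype V] [Fintype W]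
    (S : SimpleGraph W) (T : SimpleGraph V) : ℝ :=
  (embCount T S (Fintype.card W) : ℝ) / (subtreeCount T (Fintype.card W) : ℝ)

/-- `max { d(S,T) : T an n-vertex tree }`. -/
noncomputable def maxDensity {W : Type*} [Fintype W] (S : SimpleGraph W) (n : ℕ) : ℝ :=
  sSup {x : ℝ | ∃ T : SimpleGraph (Fin n), T.IsTree ∧ x = density S T}

/-- The inducibility of `S`: `limsup_{n → ∞} max { d(S,T) : T an n-vertex tree }`. -/
noncomputable def inducibility {W : Type*} [Fintype W] (S : SimpleGraph W) : ℝ :=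
  Filter.limsup (maxDensity S) Filter.atTop

/-- A graph is starlike if it has at most one non-leaf vertex. -/
def IsStarlike {V : Type*} (G : SimpleGraph V) : Prop :=
  {v | ndeg G v ≠ 1}.Subsingleton

/-- A graph is pathlike if its maximum degree is at most 2. -/
def IsPathlike {V : Type*} (G : SimpleGraph V) : Prop :=
  ∀ v, ndeg G v ≤ 2

/-- The vertex set of the component of `u` in `G - v`; together with the edge `uv`, this is
the branch of `G` rooted at `v` through its neighbour `u`. -/
def branchSet {V : Type*} (G : SimpleGraph V) (v u : V) : Set V :=
  {w | ∃ p : G.Walk u w, v ∉ p.support}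

/-- The branch of `G` rooted at `v` through `u` is non-trivial if it is not a single edge. -/
def NontrivialBranch {V : Type*} (G : SimpleGraph V) (v u : V) : Prop :=
  G.Adj v u ∧ branchSet G v u ≠ {u}

/-- The branch rooted at `v` through `u` is a fork: non-trivial and isomorphic to a star in
which `v` is a leaf (all vertices of the branch other than `u` and `v` are leaves of `G`). -/
def IsFork {V : Type*} (G : SimpleGraph V) (v u : V) : Prop :=
  NontrivialBranch G v u ∧ ∀ w ∈ branchSet G v u, w ≠ u → ndeg G w = 1

/-- The order of a fork: its number of leaves other than the root. -/
noncomputable def forkOrder {V : Type*} (G : SimpleGraph V) (v u : V) : ℕ :=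
  (branchSet G v u).ncard - 1

/-- A branch is major if it is non-trivial and not a fork. -/
def IsMajor {V : Type*} (G : SimpleGraph V) (v u : V) : Prop :=
  NontrivialBranch G v u ∧ ¬ IsFork G v u

/-- A caterpillar is a tree in which every vertex is the root of at most two
non-trivial branches. -/
def IsCaterpillar {V : Type*} (G : SimpleGraph V) : Prop :=
  G.IsTree ∧ ∀ v, {u | NontrivialBranch G v u}.ncard ≤ 2

/-- A center of `G`: each branch rooted at `v` has at most `|G|/2` edges (the branch through
a neighbour `u` has `(branchSet G v u).ncard` edges). -/
def IsCenter {V : Type*} [Fintype V] (G : SimpleGraph V) (v : V) : Prop :=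
  ∀ u, G.Adj v u → 2 * (branchSet G v u).ncard ≤ Fintype.card V

/-- `v` is the root of at least three non-trivial branches. -/
def RootsThreeNontrivial {V : Type*} (G : SimpleGraph V) (v : V) : Prop :=
  3 ≤ {u | NontrivialBranch G v u}.ncard

/-- A hub of `G`: a vertex `v` that is the only vertex on the path from `v` to the nearest
center of `G` that is the root of at least three non-trivial branches.  (A vertex `w` lies on
the path from `v` to `c` iff `dist v w + dist w c = dist v c`.) -/
def IsHub {V : Type*} [Fintype V] (G : SimpleGraph V) (v : V) : Prop :=
  RootsThreeNontrivial G v ∧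
  ∃ c, IsCenter G c ∧ (∀ c', IsCenter G c' → G.dist v c ≤ G.dist v c') ∧
    ∀ w, G.dist v w + G.dist w c = G.dist v c → w ≠ v → ¬ RootsThreeNontrivial G w

namespace TreeDensity

section Numeric

/-- A weak form of log-concavity. -/
def WeakLC (f : ℕ → ℕ) : Prop :=
  ∀ n, 1 ≤ n → 7 * f n < f (n + 1) → f (n + 1) * f (n + 1) ≤ 7 * f n * f (n + 2)

lemma weakLC_of_sq_le {f : ℕ → ℕ}
    (h : ∀ n, 1 ≤ n → f (n + 1) * f (n + 1) ≤ f n * (6 * f (n + 2) + f (n + 1))) :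
    WeakLC f := by
  intro n hn hlt
  have h1 := h n hn
  have h2 : 7 * f n * f (n + 1) ≤ f (n + 1) * f (n + 1) := Nat.mul_le_mul_right _ hlt.le
  nlinarith

lemma WeakLC.le_succ {f : ℕ → ℕ} (h : WeakLC f) {n : ℕ} (hn : 1 ≤ n)
    (hlt : 7 * f n < f (n + 1)) : f (n + 1) ≤ f (n + 2) := by
  have h1 := h n hn hlt
  have h2 : 7 * f n * f (n + 2) ≤ f (n + 1) * f (n + 2) := Nat.mul_le_mul_right _ hlt.le
  exact Nat.le_of_mul_le_mul_left (h1.trans h2) (by omega)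

lemma exchange_aux {f g : ℕ → ℕ} (hf : WeakLC f) {a b : ℕ} (ha : 1 ≤ a)
    (hN : f (b + 1) * g (a + 1) ≤ f (a + 1) * g (b + 1))
    (h1 : 7 * f a < f (a + 1)) (h2 : g (b + 1) ≤ 7 * g b) (hpos : 0 < f (a + 1) * g (b + 1)) :
    (b ≠ a + 1 ∧ f (a + 1) * g (b + 1) ≤ 49 * (f (a + 2) * g b)) ∨
      (f (a + 1) ≤ 49 * f a ∧ g (b + 1) ≤ 49 * g b) := by
  have h3 := hf.le_succ ha h1
  by_cases hba : b = a + 1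
  · right
    subst hba
    refine ⟨?_, by omega⟩
    have hg : 0 < g (a + 1) := by
      by_contra h0
      have : g (a + 1) = 0 := by omega
      rw [this] at h2
      have : g (a + 1 + 1) = 0 := by omega
      rw [this] at hpos
      omega
    have h4 : f (a + 2) * g (a + 1) ≤ (7 * f (a + 1)) * g (a + 1) := by
      calc f (a + 2) * g (a + 1) ≤ f (a + 1) * g (a + 2) := hN
        _ ≤ f (a + 1) * (7 * g (a + 1)) := Nat.mul_le_mul_left _ h2
        _ = _ := by ring
    have h5 : f (a + 2) ≤ 7 * f (a + 1) := Nat.le_of_mul_le_mul_right h4 hg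
    have h6 := hf a ha h1
    have h7 : f (a + 1) * f (a + 1) ≤ f (a + 1) * (49 * f a) := by
      calc _ ≤ 7 * f a * f (a + 2) := h6
        _ ≤ 7 * f a * (7 * f (a + 1)) := Nat.mul_le_mul_left _ h5
        _ = _ := by ring
    exact Nat.le_of_mul_le_mul_left h7 (by omega)
  · left
    refine ⟨hba, ?_⟩
    calc _ ≤ f (a + 2) * (7 * g b) := Nat.mul_le_mul h3 h2
      _ ≤ _ := by nlinarith [Nat.zero_le (f (a + 2) * g b)]

lemma exchange_trichotomy {f g : ℕ → ℕ} (hf : WeakLC f) (hg : WeakLC g) {a b : ℕ} (ha : 1 ≤ a)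
    (hb : 1 ≤ b) (hN : f (b + 1) * g (a + 1) ≤ f (a + 1) * g (b + 1))
    (hpos : 0 < f (a + 1) * g (b + 1)) :
    (b ≠ a + 1 ∧ f (a + 1) * g (b + 1) ≤ 49 * (f (a + 2) * g b)) ∨
    (a ≠ b + 1 ∧ f (a + 1) * g (b + 1) ≤ 49 * (f a * g (b + 2))) ∨
      (f (a + 1) ≤ 49 * f a ∧ g (b + 1) ≤ 49 * g b) := by
  rcases Nat.lt_or_ge (7 * f a) (f (a + 1)) with h1 | h1
  · rcases Nat.lt_or_ge (7 * g b) (g (b + 1)) with h2 | h2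
    · have h3 := hf a ha h1
      have h4 := hg b hb h2
      set N := f (a + 1) * g (b + 1) with hNdef
      set X := f (a + 2) * g b with hX
      set Y := f a * g (b + 2) with hY
      have h5 : N * N ≤ 49 * (X * Y) := by
        calc N * N = (f (a + 1) * f (a + 1)) * (g (b + 1) * g (b + 1)) := by rw [hNdef]; ring
          _ ≤ (7 * f a * f (a + 2)) * (7 * g b * g (b + 2)) := Nat.mul_le_mul h3 h4
          _ = _ := by rw [hX, hY]; ring
      by_cases hba : b = a + 1
      · right; left
        refine ⟨by omega, ?_⟩
        have hXN : X ≤ N := by subst hba; exact hN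
        have : N * N ≤ N * (49 * Y) := by
          calc _ ≤ 49 * (X * Y) := h5
            _ ≤ 49 * (N * Y) := by gcongr
            _ = _ := by ring
        exact Nat.le_of_mul_le_mul_left this hpos
      by_cases hab : a = b + 1
      · left
        refine ⟨by omega, ?_⟩
        have hYN : Y ≤ N := by subst hab; exact hN
        have : N * N ≤ N * (49 * X) := by
          calc _ ≤ 49 * (X * Y) := h5
            _ ≤ 49 * (X * N) := by gcongr
            _ = _ := by ring
        exact Nat.le_of_mul_le_mul_left this hpos
      rcases Nat.le_total N (49 * X) with h | h
      · exact Or.inl ⟨hba, h⟩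
      · right; left
        refine ⟨hab, ?_⟩
        by_contra! hlt
        nlinarith [Nat.zero_le X, Nat.zero_le Y]
    · rcases exchange_aux hf ha hN h1 h2 hpos with h | h
      · exact Or.inl h
      · exact Or.inr (Or.inr h)
  · rcases Nat.lt_or_ge (7 * g b) (g (b + 1)) with h2 | h2
    · rw [mul_comm, mul_comm (f (a + 1))] at hN
      rw [mul_comm] at hpos
      rcases exchange_aux hg hb hN h2 h1 hpos with h | h
      · right; left
        refine ⟨h.1, ?_⟩
        rw [mul_comm (f (a + 1)), mul_comm (f a)]
        exact h.2
      · exact Or.inr (Or.inr h.symm)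
    · exact Or.inr (Or.inr ⟨by omega, by omega⟩)

/-- The consecutive case `b = a + 1`. -/
lemma exchange_succ {f g : ℕ → ℕ} (hg : WeakLC g) {a : ℕ} (ha : 1 ≤ a)
    (hf : f (a + 1) ≤ 49 * f a) :
    f (a + 1) * g (a + 2) ≤ 49 * (f a * g (a + 3)) ∨
      f (a + 1) * g (a + 2) ≤ 343 * (f (a + 1) * g a) := by
  rcases Nat.lt_or_ge (7 * g (a + 1)) (g (a + 2)) with h1 | h1
  · left
    have := hg.le_succ (n := a + 1) (by omega) h1
    calc _ ≤ (49 * f a) * g (a + 3) := Nat.mul_le_mul hf this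
      _ = _ := by ring
  · right
    have key : g (a + 1) ≤ 49 * g a := by
      rcases Nat.lt_or_ge (7 * g a) (g (a + 1)) with h2 | h2
      · have h3 := hg a ha h2
        have : g (a + 1) * g (a + 1) ≤ g (a + 1) * (49 * g a) := by
          calc _ ≤ _ := h3
            _ ≤ 7 * g a * (7 * g (a + 1)) := Nat.mul_le_mul_left _ h1
            _ = _ := by ring
        exact Nat.le_of_mul_le_mul_left this (by omega)
      · omega
    calc f (a + 1) * g (a + 2) ≤ f (a + 1) * (343 * g a) := Nat.mul_le_mul_left _ (by omega)
      _ = _ := by ring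

end Numeric

open scoped Classical

set_option linter.unusedSectionVars false

section Branch

variable {V : Type*} {G : SimpleGraph V}

lemma mem_branchSet_self {x i : V} (h : x ≠ i) : i ∈ branchSet G x i :=
  ⟨Walk.nil, by simpa using h⟩

lemma not_mem_branchSet_root {x i : V} : x ∉ branchSet G x i := by
  rintro ⟨p, hp⟩
  exact hp p.end_mem_support

lemma mem_branchSet_of_walk {x i w w' : V} (hw : w ∈ branchSet G x i) (p : G.Walk w w')
    (hp : x ∉ p.support) : w' ∈ branchSet G x i := by
  obtain ⟨q, hq⟩ := hw
  refine ⟨q.append p, ?_⟩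
  rw [Walk.mem_support_append_iff]
  tauto

lemma mem_branchSet_of_adj {x i w w' : V} (hw : w ∈ branchSet G x i) (h : G.Adj w w')
    (hx : w' ≠ x) : w' ∈ branchSet G x i := by
  refine mem_branchSet_of_walk hw h.toWalk ?_
  have : x ≠ w := by rintro rfl; exact not_mem_branchSet_root hw
  simp [this, hx.symm]

lemma exists_mem_branchSet_of_path {x w : V} (h : w ≠ x) (p : G.Walk x w) (hp : p.IsPath) :
    ∃ i, G.Adj x i ∧ i ∈ p.support ∧ w ∈ branchSet G x i := by
  cases p with
  | nil => exact absurd rfl h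
  | cons hadj q =>
    rw [Walk.cons_isPath_iff] at hp
    exact ⟨_, hadj, by simp, q, hp.2⟩

lemma exists_mem_branchSet (hG : G.Connected) {x w : V} (h : w ≠ x) :
    ∃ i, G.Adj x i ∧ w ∈ branchSet G x i := by
  obtain ⟨p, hp⟩ := hG.exists_isPath x w
  obtain ⟨i, h1, -, h2⟩ := exists_mem_branchSet_of_path h p hp
  exact ⟨i, h1, h2⟩

lemma branchSet_inj (hG : G.IsAcyclic) {x i j w : V} (hi : G.Adj x i) (hj : G.Adj x j)
    (hwi : w ∈ branchSet G x i) (hwj : w ∈ branchSet G x j) : i = j := by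
  obtain ⟨p, hp⟩ := hwi
  obtain ⟨q, hq⟩ := hwj
  have h1 : (Walk.cons hi p.toPath.1).IsPath := by
    rw [Walk.cons_isPath_iff]
    exact ⟨p.toPath.2, fun h => hp (Walk.support_bypass_subset_support _ h)⟩
  have h2 : (Walk.cons hj q.toPath.1).IsPath := by
    rw [Walk.cons_isPath_iff]
    exact ⟨q.toPath.2, fun h => hq (Walk.support_bypass_subset_support _ h)⟩
  have h3 := (hG.subsingleton_path x w).elim ⟨_, h1⟩ ⟨_, h2⟩
  simp only [Subtype.mk.injEq] at h3
  have h4 := congrArg Walk.snd h3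
  simpa using h4

lemma branchSet_subset {x i y j : V} (hy : y ∈ branchSet G x i) (hj : G.Adj y j)
    (hx : x ∉ branchSet G y j) : branchSet G y j ⊆ branchSet G x i := by
  rintro w ⟨p, hp⟩
  have hjx : j ≠ x := by rintro rfl; exact hx (mem_branchSet_self hj.ne)
  refine mem_branchSet_of_walk (mem_branchSet_of_adj hy hj hjx) p ?_
  intro hxp
  exact hx ⟨p.takeUntil x hxp, fun h => hp (p.support_takeUntil_subset_support hxp h)⟩

lemma mem_branchSet_of_notMem (hG : G.IsTree) {x i y j w : V} (hi : G.Adj x i)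
    (hy : y ∈ branchSet G x i) (hx : x ∈ branchSet G y j)
    (hw : w ∉ branchSet G x i) : w ∈ branchSet G y j := by
  by_cases hwx : w = x
  · rwa [hwx]
  obtain ⟨i', hi', p, hp⟩ := exists_mem_branchSet hG.1 hwx
  have hne : i' ≠ i := by rintro rfl; exact hw ⟨p, hp⟩
  have hy' : y ∉ p.support := by
    intro h
    refine hne (branchSet_inj hG.2 hi' hi (w := y) ⟨p.takeUntil y h, fun h' => ?_⟩ hy)
    exact hp (p.support_takeUntil_subset_support h h')
  have : i' ≠ y := by rintro rfl; exact hy' p.start_mem_support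
  exact mem_branchSet_of_walk (mem_branchSet_of_adj hx hi' this) p hy'

lemma dist_lt_of_mem_branchSet (hG : G.IsTree) {m j w : V} (hj : G.Adj m j)
    (hw : w ∈ branchSet G m j) : G.dist j w + 1 ≤ G.dist m w := by
  obtain ⟨p, hp, hl⟩ := hG.1.exists_path_of_dist m w
  cases p with
  | nil => exact absurd hw not_mem_branchSet_root
  | cons hadj q =>
    rw [Walk.cons_isPath_iff] at hp
    have := branchSet_inj hG.2 hadj hj ⟨q, hp.2⟩ hw
    subst this
    rw [← hl, Walk.length_cons]
    have := dist_le q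
    omega

lemma dist_lt_of_separated (hG : G.Connected) {x z p y : V} (hp : p ∉ branchSet G x z)
    (hy : y ∈ branchSet G x z) (hpx : p ≠ x) : G.dist y x < G.dist y p := by
  obtain ⟨q, -, hl⟩ := hG.exists_path_of_dist y p
  by_cases hx : x ∈ q.support
  · have h1 := dist_le (q.takeUntil x hx)
    have h2 := q.length_takeUntil_lt_length hx hpx.symm
    omega
  · exact absurd (mem_branchSet_of_walk hy q hx) hp

lemma dist_add_of_separated (hG : G.Connected) {x z p y : V} (hp : p ∉ branchSet G x z)
    (hy : y ∈ branchSet G x z) : G.dist y x + G.dist x p = G.dist y p := by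
  obtain ⟨q, -, hl⟩ := hG.exists_path_of_dist y p
  by_cases hx : x ∈ q.support
  · have h1 := dist_le (q.takeUntil x hx)
    have h2 := dist_le (q.dropUntil x hx)
    have h3 := congrArg Walk.length (q.take_spec hx)
    rw [Walk.length_append] at h3
    have := hG.dist_triangle (u := y) (v := x) (w := p)
    omega
  · exact absurd (mem_branchSet_of_walk hy q hx) hp

end Branch

section Conn

variable {V : Type*} {G : SimpleGraph V}

/-- The finite set `s` spans a connected subgraph of `G`. -/
def Conn (G : SimpleGraph V) (s : Finset V) : Prop := (G.induce (s : Set V)).Connected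

lemma Conn.exists_walk {s : Finset V} (hs : Conn G s) {x y : V} (hx : x ∈ s) (hy : y ∈ s) :
    ∃ p : G.Walk x y, p.IsPath ∧ ∀ w ∈ p.support, w ∈ s := by
  obtain ⟨p, hp⟩ := hs.exists_isPath ⟨x, hx⟩ ⟨y, hy⟩
  let f : G.induce (s : Set V) →g G := (Embedding.induce (s : Set V)).toHom
  have hx' : f ⟨x, hx⟩ = x := rfl
  have hy' : f ⟨y, hy⟩ = y := rfl
  refine ⟨(p.map f).copy hx' hy', ?_, ?_⟩
  · rw [Walk.isPath_copy]
    exact hp.map Subtype.val_injective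
  · intro w hw
    rw [Walk.support_copy, Walk.support_map, List.mem_map] at hw
    obtain ⟨a, -, rfl⟩ := hw
    exact a.2

lemma Conn.nbr_mem (hG : G.IsTree) {s : Finset V} (hs : Conn G s) {x w i : V} (hx : x ∈ s)
    (hw : w ∈ s) (hi : G.Adj x i) (hwi : w ∈ branchSet G x i) : i ∈ s := by
  obtain ⟨p, hp, hps⟩ := hs.exists_walk hx hw
  have hne : w ≠ x := by rintro rfl; exact not_mem_branchSet_root hwi
  obtain ⟨j, hj, hjp, hwj⟩ := exists_mem_branchSet_of_path hne p hp
  have := branchSet_inj hG.2 hi hj hwi hwj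
  exact this ▸ hps j hjp

lemma Conn.same_branch {s : Finset V} (hs : Conn G s) {x y w i : V} (hx : x ∉ s)
    (hy : y ∈ s) (hw : w ∈ s) (hyi : y ∈ branchSet G x i) : w ∈ branchSet G x i := by
  obtain ⟨p, -, hps⟩ := hs.exists_walk hy hw
  exact mem_branchSet_of_walk hyi p fun h => hx (hps x h)

lemma conn_iff (hG : G.IsTree) {s : Finset V} {x : V} (hx : x ∈ s) :
    Conn G s ↔ ∀ w ∈ s, ∀ j, G.Adj w j → x ∈ branchSet G w j → j ∈ s := by
  refine ⟨fun hs w hw j hj hxj => hs.nbr_mem hG hw hx hj hxj, fun h => ?_⟩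
  have key : ∀ {w y : V} (p : G.Walk w y), p.IsPath →
      (∀ w ∈ s, ∀ j, G.Adj w j → y ∈ branchSet G w j → j ∈ s) → ∀ (hw : w ∈ s) (hy : y ∈ s),
      (G.induce (s : Set V)).Reachable ⟨w, hw⟩ ⟨y, hy⟩ := by
    intro w y p
    induction p with
    | nil => intro _ _ _ _; exact Reachable.refl _
    | cons hadj q ih =>
      intro hp h hw hy
      rw [Walk.cons_isPath_iff] at hp
      have hj := h _ hw _ hadj ⟨q, hp.2⟩
      refine Reachable.trans (Adj.reachable ?_) (ih hp.1 h hj hy)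
      simpa using hadj
  have : Nonempty (s : Set V) := ⟨⟨x, hx⟩⟩
  refine Connected.mk ?_
  have hr : ∀ a : (s : Set V), (G.induce (s : Set V)).Reachable a ⟨x, hx⟩ := by
    rintro ⟨w, hw⟩
    obtain ⟨p, hp⟩ := hG.1.exists_isPath w x
    exact key p hp h hw hx
  exact fun a b => (hr a).trans (hr b).symm

lemma Conn.dist_lt_card {s : Finset V} (hs : Conn G s) {x y : V} (hx : x ∈ s) (hy : y ∈ s) :
    G.dist x y < s.card := by
  obtain ⟨p, hp, hps⟩ := hs.exists_walk hx hy
  have h1 := dist_le p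
  have h2 : p.support.toFinset ⊆ s := fun w hw => hps w (by simpa using hw)
  have h3 := Finset.card_le_card h2
  rw [List.toFinset_card_of_nodup hp.support_nodup, Walk.length_support] at h3
  omega

lemma Conn.nonempty {s : Finset V} (hs : Conn G s) : s.Nonempty := by
  obtain ⟨⟨x, hx⟩⟩ := SimpleGraph.Connected.nonempty hs
  exact ⟨x, hx⟩

lemma Conn.insert (hG : G.IsTree) {s : Finset V} (hs : Conn G s) {p q : V} (hq : q ∈ s)
    (hpq : G.Adj p q) : Conn G (insert p s) := by
  by_cases hp : p ∈ s
  · rwa [Finset.insert_eq_of_mem hp]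
  rw [conn_iff hG (Finset.mem_insert_of_mem hq)]
  intro w hw j hj hqj
  rcases Finset.mem_insert.1 hw with rfl | hw
  · have := branchSet_inj hG.2 hj hpq hqj (mem_branchSet_self hpq.ne)
    exact this ▸ Finset.mem_insert_of_mem hq
  · exact Finset.mem_insert_of_mem (hs.nbr_mem hG hw hq hj hqj)

end Conn

section BranchCard

variable {V : Type*} {G : SimpleGraph V}

/-- The part of `s` in the branch of `G` rooted at `x` through `l`. -/
noncomputable def part (G : SimpleGraph V) (s : Finset V) (x l : V) : Finset V :=
  s.filter (· ∈ branchSet G x l)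

/-- The number of vertices of `s` in the branch of `G` rooted at `x` through a neighbour `l`
of `x`; it is `0` if `l` is not a neighbour of `x`. -/
noncomputable def brCard (G : SimpleGraph V) (s : Finset V) (x l : V) : ℕ :=
  if G.Adj x l then (part G s x l).card else 0

lemma mem_part {s : Finset V} {x l w : V} : w ∈ part G s x l ↔ w ∈ s ∧ w ∈ branchSet G x l := by
  simp [part]

lemma brCard_of_adj {s : Finset V} {x l : V} (h : G.Adj x l) :
    brCard G s x l = (part G s x l).card := by
  simp [brCard, h]

lemma adj_of_brCard_pos {s : Finset V} {x l : V} (h : 0 < brCard G s x l) : G.Adj x l := by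
  by_contra h'
  simp [brCard, h'] at h

lemma brCard_congr {s s' : Finset V} {x l : V}
    (h : ∀ w ∈ branchSet G x l, w ∈ s ↔ w ∈ s') : brCard G s x l = brCard G s' x l := by
  have : part G s x l = part G s' x l := by
    ext w
    simp only [mem_part]
    constructor <;> rintro ⟨h1, h2⟩
    · exact ⟨(h w h2).1 h1, h2⟩
    · exact ⟨(h w h2).2 h1, h2⟩
  simp [brCard, this]

lemma Conn.mem_of_brCard_pos (hG : G.IsTree) {s : Finset V} (hs : Conn G s) {x l : V}
    (hx : x ∈ s) (h : 0 < brCard G s x l) : l ∈ s := by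
  have hl := adj_of_brCard_pos h
  rw [brCard_of_adj hl] at h
  obtain ⟨w, hw⟩ := Finset.card_pos.1 h
  rw [mem_part] at hw
  exact hs.nbr_mem hG hx hw.1 hl hw.2

lemma part_disjoint (hG : G.IsTree) (s : Finset V) {x i j : V} (hi : G.Adj x i) (hj : G.Adj x j)
    (hij : i ≠ j) : Disjoint (part G s x i) (part G s x j) := by
  rw [Finset.disjoint_left]
  intro w h1 h2
  exact hij (branchSet_inj hG.2 hi hj (mem_part.1 h1).2 (mem_part.1 h2).2)

lemma brCard_add_compl (s : Finset V) {x i : V} (hi : G.Adj x i) :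
    brCard G s x i + (s.filter (· ∉ branchSet G x i)).card = s.card := by
  rw [brCard_of_adj hi]
  exact Finset.card_filter_add_card_filter_not _

lemma sum_brCard [Fintype V] (hG : G.IsTree) {s : Finset V} {x : V} (hx : x ∈ s) :
    ∑ l, brCard G s x l + 1 = s.card := by
  have h1 : ∑ l, brCard G s x l = ∑ l ∈ Finset.univ.filter (G.Adj x), (part G s x l).card := by
    rw [Finset.sum_filter]
    rfl
  rw [h1, ← Finset.card_biUnion]
  · rw [← Finset.card_erase_add_one hx]
    congr 2
    ext w
    simp only [Finset.mem_biUnion, Finset.mem_filter, Finset.mem_univ, true_and, mem_part,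
      Finset.mem_erase]
    constructor
    · rintro ⟨l, -, hw, hl⟩
      exact ⟨by rintro rfl; exact not_mem_branchSet_root hl, hw⟩
    · rintro ⟨hne, hw⟩
      obtain ⟨i, hi, h⟩ := exists_mem_branchSet hG.1 hne
      exact ⟨i, hi, hw, h⟩
  · intro i hi j hj hij
    simp only [Finset.coe_filter, Finset.mem_univ, true_and, Set.mem_ofPred_eq] at hi hj
    exact part_disjoint hG s hi hj hij

/-- The number of branches at `x` whose part in `s` has a size satisfying `P`. -/
noncomputable def brNum [Fintype V] (G : SimpleGraph V) (s : Finset V) (x : V) (P : ℕ → Prop) :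
    ℕ := (Finset.univ.filter fun l => P (brCard G s x l)).card

/-- The sum of the squares of the sizes of the branches of `s` at `x`. -/
noncomputable def brSq [Fintype V] (G : SimpleGraph V) (s : Finset V) (x : V) : ℕ :=
  ∑ l, brCard G s x l ^ 2

/-- Every vertex `w` of `s` in the branch at `x` through `i` that has more than `k / 2` vertices of
`s` outside the branch towards `x` roots at most two non-trivial branches of `s`. -/
def HubCond [Fintype V] (G : SimpleGraph V) (k : ℕ) (s : Finset V) (x i : V) : Prop :=
  ∀ w ∈ s, w ∈ branchSet G x i → ∀ j, G.Adj w j → x ∈ branchSet G w j →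
    k < 2 * (s.filter (· ∉ branchSet G w j)).card → ¬ 3 ≤ brNum G s w (2 ≤ ·)

end BranchCard

section Copy

variable {V W : Type*} [Fintype V] [Fintype W] {T : SimpleGraph V} {S : SimpleGraph W}

/-- `φ` is an isomorphism from `S` onto the subgraph of `T` induced by `s`. -/
structure IsCopy (S : SimpleGraph W) (T : SimpleGraph V) (s : Finset V) (φ : W → V) : Prop where
  inj : Function.Injective φ
  adj : ∀ a b, T.Adj (φ a) (φ b) ↔ S.Adj a b
  mem : ∀ v, v ∈ s ↔ ∃ a, φ a = v

lemma nonempty_iso_iff {s : Finset V} :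
    Nonempty ((T.induce (s : Set V)) ≃g S) ↔ ∃ φ, IsCopy S T s φ := by
  constructor
  · rintro ⟨e⟩
    refine ⟨fun a => (e.symm a : V), ?_, ?_, ?_⟩
    · intro a b h
      exact e.symm.injective (Subtype.ext h)
    · intro a b
      have := e.symm.map_adj_iff (v := a) (w := b)
      rw [← this]
      rfl
    · intro v
      constructor
      · intro hv
        exact ⟨e ⟨v, hv⟩, by simp⟩
      · rintro ⟨a, rfl⟩
        exact (e.symm a).2
  · rintro ⟨φ, h⟩
    let f : W → (s : Set V) := fun a => ⟨φ a, (h.mem _).2 ⟨a, rfl⟩⟩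
    have hf : Function.Bijective f := by
      constructor
      · intro a b hab
        exact h.inj (congrArg Subtype.val hab)
      · rintro ⟨v, hv⟩
        obtain ⟨a, rfl⟩ := (h.mem _).1 hv
        exact ⟨a, rfl⟩
    let e : S ≃g (T.induce (s : Set V)) :=
      { toEquiv := Equiv.ofBijective f hf
        map_rel_iff' := by
          intro a b
          exact h.adj a b }
    exact ⟨e.symm⟩

namespace IsCopy

variable {s : Finset V} {φ : W → V}

lemma apply_mem (h : IsCopy S T s φ) (a : W) : φ a ∈ s := (h.mem _).2 ⟨a, rfl⟩

lemma conn (h : IsCopy S T s φ) (hS : S.IsTree) : Conn T s := by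
  obtain ⟨e⟩ := nonempty_iso_iff.2 ⟨φ, h⟩
  exact e.connected_iff.2 hS.1

lemma card_eq (h : IsCopy S T s φ) : s.card = Fintype.card W := by
  have : s = Finset.univ.image φ := by
    ext v
    simp [h.mem]
  rw [this, Finset.card_image_of_injective _ h.inj, Finset.card_univ]

lemma mem_branchSet (h : IsCopy S T s φ) (hS : S.IsTree) (hT : T.IsTree) {v u w : W}
    (hu : S.Adj v u) : φ w ∈ branchSet T (φ v) (φ u) ↔ w ∈ branchSet S v u := by
  have key : ∀ {u w : W}, w ∈ branchSet S v u → φ w ∈ branchSet T (φ v) (φ u) := by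
    rintro u w ⟨p, hp⟩
    let f : S →g T := ⟨φ, fun {a b} hab => (h.adj a b).2 hab⟩
    refine ⟨p.map f, ?_⟩
    intro hv
    have : (p.map f).support = p.support.map f := Walk.support_map _ _
    change φ v ∈ (p.map f).support at hv
    erw [this, List.mem_map] at hv
    obtain ⟨a, ha, hav⟩ := hv
    have : a = v := h.inj hav
    exact hp (this ▸ ha)
  refine ⟨fun hw => ?_, key⟩
  have hne : w ≠ v := by rintro rfl; exact not_mem_branchSet_root hw
  obtain ⟨i, hi, hwi⟩ := exists_mem_branchSet hS.1 hne
  have := branchSet_inj hT.2 ((h.adj _ _).2 hu) ((h.adj _ _).2 hi) hw (key hwi)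
  exact h.inj this ▸ hwi

lemma filter_card (h : IsCopy S T s φ) (P : V → Prop) [DecidablePred P] :
    (s.filter P).card = (Finset.univ.filter fun a => P (φ a)).card := by
  rw [← Finset.card_image_of_injective (Finset.univ.filter fun a => P (φ a)) h.inj]
  congr 1
  ext v
  simp only [Finset.mem_filter, h.mem, Finset.mem_image, Finset.mem_univ, true_and]
  constructor
  · rintro ⟨⟨a, rfl⟩, ha⟩
    exact ⟨a, ha, rfl⟩
  · rintro ⟨a, ha, rfl⟩
    exact ⟨⟨a, rfl⟩, ha⟩

lemma brCard_eq (h : IsCopy S T s φ) (hS : S.IsTree) (hT : T.IsTree) (v u : W) :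
    brCard T s (φ v) (φ u) = brCard S Finset.univ v u := by
  by_cases hu : S.Adj v u
  · rw [brCard_of_adj hu, brCard_of_adj ((h.adj _ _).2 hu), part, part, h.filter_card]
    congr 1
    ext w
    simp [h.mem_branchSet hS hT hu]
  · have : ¬ T.Adj (φ v) (φ u) := by rwa [h.adj]
    simp [brCard, hu, this]

lemma sum_eq (h : IsCopy S T s φ) (hS : S.IsTree) (hT : T.IsTree) (v : W) (F : ℕ → ℕ)
    (hF : F 0 = 0) :
    ∑ l, F (brCard T s (φ v) l) = ∑ u, F (brCard S Finset.univ v u) := by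
  have h1 : ∑ u, F (brCard S Finset.univ v u)
      = ∑ l ∈ Finset.univ.image φ, F (brCard T s (φ v) l) := by
    rw [Finset.sum_image (fun a _ b _ hab => h.inj hab)]
    simp [h.brCard_eq hS hT]
  rw [h1]
  symm
  refine Finset.sum_subset (Finset.subset_univ _) fun l _ hl => ?_
  have : brCard T s (φ v) l = 0 := by
    by_contra hne
    have := (h.conn hS).mem_of_brCard_pos hT (h.apply_mem v) (Nat.pos_of_ne_zero hne)
    obtain ⟨a, rfl⟩ := (h.mem _).1 this
    exact hl (Finset.mem_image_of_mem _ (Finset.mem_univ _))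
  rw [this, hF]

lemma brSq_eq (h : IsCopy S T s φ) (hS : S.IsTree) (hT : T.IsTree) (v : W) :
    brSq T s (φ v) = brSq S Finset.univ v :=
  h.sum_eq hS hT v (· ^ 2) rfl

lemma brNum_eq (h : IsCopy S T s φ) (hS : S.IsTree) (hT : T.IsTree) (v : W) (P : ℕ → Prop)
    (hP : ¬ P 0) : brNum T s (φ v) P = brNum S Finset.univ v P := by
  have := h.sum_eq hS hT v (fun n => if P n then 1 else 0) (if_neg hP)
  unfold brNum
  rw [Finset.card_filter, Finset.card_filter]
  exact this

lemma brCard_le_iff (h : IsCopy S T s φ) (hS : S.IsTree) (hT : T.IsTree) (v : W) (c : ℕ) :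
    (∀ l, brCard T s (φ v) l ≤ c) ↔ ∀ u, brCard S Finset.univ v u ≤ c := by
  have := h.brNum_eq hS hT v (c < ·) (by simp)
  have h0 : brNum T s (φ v) (c < ·) = 0 ↔ brNum S Finset.univ v (c < ·) = 0 := by rw [this]
  unfold brNum at h0
  simp only [Finset.card_eq_zero, Finset.filter_eq_empty_iff, Finset.mem_univ, true_imp_iff,
    not_lt] at h0
  exact h0

lemma hubCond (h : IsCopy S T s φ) (hS : S.IsTree) (hT : T.IsTree) {k : ℕ} {v u : W}
    (hu : S.Adj v u) (hc : HubCond S k Finset.univ v u) : HubCond T k s (φ v) (φ u) := by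
  intro w hw hwu j hj hvj hk
  obtain ⟨w, rfl⟩ := (h.mem _).1 hw
  obtain ⟨j, rfl⟩ := (h.mem _).1 ((h.conn hS).nbr_mem hT hw (h.apply_mem v) hj hvj)
  rw [h.adj] at hj
  rw [h.mem_branchSet hS hT hu] at hwu
  rw [h.mem_branchSet hS hT hj] at hvj
  rw [h.filter_card] at hk
  simp only [h.mem_branchSet hS hT hj] at hk
  rw [h.brNum_eq hS hT _ _ (by simp)]
  exact hc w (Finset.mem_univ _) hwu j hj hvj hk

end IsCopy

end Copy

section Forest

lemma sum_le_sum_of_injOn {ι κ : Type*} {s : Finset ι} {t : Finset κ} {e : ι → κ}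
    (he : ∀ a ∈ s, e a ∈ t) (hinj : Set.InjOn e s) {F : ι → ℚ} {H : κ → ℚ}
    (hle : ∀ a ∈ s, F a ≤ H (e a)) (hH : ∀ b ∈ t, 0 ≤ H b) :
    ∑ a ∈ s, F a ≤ ∑ b ∈ t, H b := by
  calc ∑ a ∈ s, F a ≤ ∑ a ∈ s, H (e a) := Finset.sum_le_sum hle
    _ = ∑ b ∈ s.image e, H b := (Finset.sum_image hinj).symm
    _ ≤ ∑ b ∈ t, H b := by
      refine Finset.sum_le_sum_of_subset_of_nonneg ?_ fun b hb _ => hH b hb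
      intro b hb
      obtain ⟨a, ha, rfl⟩ := Finset.mem_image.1 hb
      exact he a ha

variable {V : Type*} [Fintype V] (x : V) (U : Finset V) (par : V → V)

/-- The `n`-element subsets of `U` that, together with `x`, are closed under the parent map. -/
noncomputable def closedSets (n : ℕ) : Finset (Finset V) :=
  Finset.univ.filter fun A => (A ⊆ U ∧ ∀ w ∈ A, par w ∈ insert x A) ∧ A.card = n

/-- The elements of `A` that are not the parent of an element of `A`. -/
noncomputable def childless (A : Finset V) : Finset V := A.filter fun w => ∀ v ∈ A, par v ≠ w

/-- The elements that extend the closed set `R` to a larger closed set. -/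
noncomputable def addable (R : Finset V) : Finset V :=
  U.filter fun u => u ∉ R ∧ par u ∈ insert x R

variable {x U par} {n : ℕ}

lemma mem_closedSets {A : Finset V} : A ∈ closedSets x U par n ↔
    (A ⊆ U ∧ ∀ w ∈ A, par w ∈ insert x A) ∧ A.card = n := by
  simp [closedSets]

lemma mem_childless {A : Finset V} {w : V} :
    w ∈ childless par A ↔ w ∈ A ∧ ∀ v ∈ A, par v ≠ w := by
  simp [childless]

lemma mem_addable {R : Finset V} {u : V} :
    u ∈ addable x U par R ↔ u ∈ U ∧ u ∉ R ∧ par u ∈ insert x R := by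
  simp [addable]

lemma erase_mem_closedSets {A : Finset V} {w : V} (hA : A ∈ closedSets x U par (n + 1))
    (hw : w ∈ childless par A) : A.erase w ∈ closedSets x U par n := by
  rw [mem_closedSets] at hA ⊢
  rw [mem_childless] at hw
  refine ⟨⟨(Finset.erase_subset _ _).trans hA.1.1, fun v hv => ?_⟩, ?_⟩
  · rw [Finset.mem_erase] at hv
    have h1 := hA.1.2 v hv.2
    have h2 := hw.2 v hv.2
    simp only [Finset.mem_insert, Finset.mem_erase] at h1 ⊢
    tauto
  · rw [Finset.card_erase_of_mem hw.1, hA.2]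
    rfl

lemma mem_addable_erase (hpar : ∀ w ∈ U, par w ≠ w) {A : Finset V} {w : V}
    (hA : A ∈ closedSets x U par n) (hw : w ∈ childless par A) :
    w ∈ addable x U par (A.erase w) := by
  rw [mem_closedSets] at hA
  rw [mem_childless] at hw
  rw [mem_addable]
  have h1 := hA.1.2 w hw.1
  have h2 := hpar w (hA.1.1 hw.1)
  refine ⟨hA.1.1 hw.1, by simp, ?_⟩
  simp only [Finset.mem_insert, Finset.mem_erase] at h1 ⊢
  tauto

lemma insert_mem_closedSets {R : Finset V} {u : V} (hR : R ∈ closedSets x U par n)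
    (hu : u ∈ addable x U par R) : insert u R ∈ closedSets x U par (n + 1) := by
  rw [mem_closedSets] at hR ⊢
  rw [mem_addable] at hu
  refine ⟨⟨Finset.insert_subset hu.1 hR.1.1, fun v hv => ?_⟩, ?_⟩
  · rw [Finset.mem_insert] at hv
    rcases hv with rfl | hv
    · have := hu.2.2
      simp only [Finset.mem_insert] at this ⊢
      tauto
    · have := hR.1.2 v hv
      simp only [Finset.mem_insert] at this ⊢
      tauto
  · rw [Finset.card_insert_of_notMem hu.2.1, hR.2]

lemma childless_nonempty {ρ : V → ℕ} (hρ : ∀ w ∈ U, ρ (par w) < ρ w) {A : Finset V}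
    (hA : A ∈ closedSets x U par (n + 1)) : (childless par A).Nonempty := by
  rw [mem_closedSets] at hA
  have hne : A.Nonempty := Finset.card_pos.1 (by omega)
  obtain ⟨w, hw, hmax⟩ := A.exists_max_image ρ hne
  refine ⟨w, mem_childless.2 ⟨hw, ?_⟩⟩
  rintro v hv rfl
  have := hmax v hv
  have := hρ v (hA.1.1 hv)
  omega

lemma card_childless_erase_le {A : Finset V} {w : V} (hw : w ∈ childless par A) :
    (childless par (A.erase w)).card ≤ (childless par A).card := by
  have h : childless par (A.erase w) ⊆ insert (par w) ((childless par A).erase w) := by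
    intro v hv
    rw [mem_childless, Finset.mem_erase] at hv
    rw [Finset.mem_insert, Finset.mem_erase, mem_childless]
    by_cases hvw : v = par w
    · exact Or.inl hvw
    · refine Or.inr ⟨hv.1.1, hv.1.2, fun u hu => ?_⟩
      by_cases huw : u = w
      · subst huw
        exact Ne.symm hvw
      · exact hv.2 u (Finset.mem_erase.2 ⟨huw, hu⟩)
  have h1 := Finset.card_le_card h
  have h2 := Finset.card_insert_le (par w) ((childless par A).erase w)
  have h3 := Finset.card_erase_add_one hw
  omega

lemma insert_insert_facts (hx : x ∉ U) {R : Finset V} {u u' : V}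
    (hR : R ∈ closedSets x U par n) (hu : u ∈ addable x U par R) (hu' : u' ∈ addable x U par R)
    (hne : u ≠ u') :
    insert u' (insert u R) ∈ closedSets x U par (n + 2) ∧
      u ∈ childless par (insert u' (insert u R)) ∧
      u' ∈ childless par (insert u' (insert u R)) ∧
      ((insert u' (insert u R)).erase u').erase u = R ∧
      (childless par (insert u' (insert u R))).card ≤ (childless par R).card + 2 := by
  have hu1 := mem_addable.1 hu
  have hu1' := mem_addable.1 hu'
  have hux : u ≠ x := by rintro rfl; exact hx hu1.1
  have hux' : u' ≠ x := by rintro rfl; exact hx hu1'.1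
  have hR1 := mem_closedSets.1 hR
  have hpR : ∀ v ∈ insert u' (insert u R), par v ∈ insert x R := by
    intro v hv
    simp only [Finset.mem_insert] at hv
    rcases hv with rfl | rfl | hv
    · exact hu1'.2.2
    · exact hu1.2.2
    · exact hR1.1.2 v hv
  have hnot : ∀ z, z ≠ x → z ∉ R → ∀ v ∈ insert u' (insert u R), par v ≠ z := by
    rintro z hz hzR v hv rfl
    have := hpR v hv
    rw [Finset.mem_insert] at this
    tauto
  refine ⟨?_, ?_, ?_, ?_, ?_⟩
  · refine insert_mem_closedSets (insert_mem_closedSets hR hu) (mem_addable.2 ⟨hu1'.1, ?_, ?_⟩)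
    · rw [Finset.mem_insert]
      rintro (h | h)
      · exact hne h.symm
      · exact hu1'.2.1 h
    · have := hu1'.2.2
      simp only [Finset.mem_insert] at this ⊢
      tauto
  · exact mem_childless.2 ⟨by simp, hnot u hux hu1.2.1⟩
  · exact mem_childless.2 ⟨by simp, hnot u' hux' hu1'.2.1⟩
  · rw [Finset.erase_insert, Finset.erase_insert hu1.2.1]
    rw [Finset.mem_insert]
    rintro (h | h)
    · exact hne h.symm
    · exact hu1'.2.1 h
  · have h : childless par (insert u' (insert u R)) ⊆ insert u' (insert u (childless par R)) := by
      intro v hv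
      rw [mem_childless] at hv
      have h1 := hv.1
      simp only [Finset.mem_insert] at h1 ⊢
      rcases h1 with h1 | h1 | h1
      · exact Or.inl h1
      · exact Or.inr (Or.inl h1)
      · exact Or.inr (Or.inr (mem_childless.2 ⟨h1, fun z hz => hv.2 z (by simp [hz])⟩))
    have h1 := Finset.card_le_card h
    have h2 := Finset.card_insert_le u' (insert u (childless par R))
    have h3 := Finset.card_insert_le u (childless par R)
    omega

/-- `1` over the number of childless elements (or `1` if there are none). -/
noncomputable def leafWeight (par : V → V) (R : Finset V) : ℚ :=
  ((max (childless par R).card 1 : ℕ) : ℚ)⁻¹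

lemma leafWeight_nonneg (R : Finset V) : 0 ≤ leafWeight par R := by
  unfold leafWeight
  positivity

lemma leafWeight_le_one (R : Finset V) : leafWeight par R ≤ 1 := by
  unfold leafWeight
  refine inv_le_one_of_one_le₀ ?_
  exact_mod_cast le_max_right _ _

lemma card_le_sum_leafWeight {ρ : V → ℕ} (hρ : ∀ w ∈ U, ρ (par w) < ρ w) :
    ((closedSets x U par (n + 1)).card : ℚ) ≤
      ∑ R ∈ closedSets x U par n, (addable x U par R).card * leafWeight par R := by
  have hpar : ∀ w ∈ U, par w ≠ w := fun w hw h => by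
    have := hρ w hw
    rw [h] at this
    exact lt_irrefl _ this
  have h1 : ((closedSets x U par (n + 1)).card : ℚ) =
      ∑ p ∈ (closedSets x U par (n + 1)).sigma (fun A => childless par A),
        ((childless par p.1).card : ℚ)⁻¹ := by
    rw [Finset.sum_sigma, Finset.card_eq_sum_ones, Nat.cast_sum]
    refine Finset.sum_congr rfl fun A hA => ?_
    have : ((childless par A).card : ℚ) ≠ 0 := by
      have := (childless_nonempty hρ hA).card_pos
      positivity
    simp [this]
  have h2 : ∑ R ∈ closedSets x U par n, (addable x U par R).card * leafWeight par R =
      ∑ p ∈ (closedSets x U par n).sigma (fun R => addable x U par R), leafWeight par p.1 := by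
    rw [Finset.sum_sigma]
    simp
  rw [h1, h2]
  refine sum_le_sum_of_injOn (e := fun p => ⟨p.1.erase p.2, p.2⟩) ?_ ?_ ?_ ?_
  · rintro ⟨A, w⟩ h
    rw [Finset.mem_sigma] at h ⊢
    exact ⟨erase_mem_closedSets h.1 h.2, mem_addable_erase hpar h.1 h.2⟩
  · rintro ⟨A, w⟩ h ⟨A', w'⟩ h' heq
    simp only [Finset.coe_sigma, Set.mem_sigma_iff, Finset.mem_coe] at h h'
    simp only [Sigma.mk.injEq, heq_eq_eq] at heq ⊢
    obtain ⟨h1, rfl⟩ := heq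
    refine ⟨?_, rfl⟩
    rw [← Finset.insert_erase (mem_childless.1 h.2).1, h1,
      Finset.insert_erase (mem_childless.1 h'.2).1]
  · rintro ⟨A, w⟩ h
    rw [Finset.mem_sigma] at h
    have h3 := card_childless_erase_le h.2
    have h4 := (childless_nonempty hρ h.1).card_pos
    unfold leafWeight
    refine inv_anti₀ (by positivity) ?_
    exact_mod_cast max_le h3 h4
  · exact fun _ _ => leafWeight_nonneg _

lemma pairs_le_six (ν : ℕ) :
    ((ν * ν - ν : ℕ) : ℚ) * (((max (ν - 2) 1 : ℕ) : ℚ)⁻¹) ^ 2 ≤ 6 := by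
  have hpos : (0 : ℚ) < ((max (ν - 2) 1 : ℕ) : ℚ) := by
    exact_mod_cast lt_of_lt_of_le one_pos (le_max_right _ _)
  rw [inv_pow, mul_inv_le_iff₀ (by positivity)]
  norm_cast
  rcases Nat.lt_or_ge ν 3 with h3 | h3
  · interval_cases ν <;> norm_num
  · obtain ⟨m, rfl⟩ := Nat.exists_eq_add_of_le h3
    have : max (3 + m - 2) 1 = m + 1 := by omega
    rw [this]
    have : (3 + m) * (3 + m) - (3 + m) = (3 + m) * (2 + m) := by
      have : (3 + m) * (3 + m) = (3 + m) * (2 + m) + (3 + m) := by ring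
      omega
    rw [this]
    nlinarith

lemma sum_pairs_le (hx : x ∉ U) :
    ∑ R ∈ closedSets x U par n,
      ((addable x U par R).offDiag.card : ℚ) * leafWeight par R ^ 2 ≤
      6 * (closedSets x U par (n + 2)).card := by
  have h2 : ∑ R ∈ closedSets x U par n,
      ((addable x U par R).offDiag.card : ℚ) * leafWeight par R ^ 2 =
      ∑ p ∈ (closedSets x U par n).sigma (fun R => (addable x U par R).offDiag),
        leafWeight par p.1 ^ 2 := by
    rw [Finset.sum_sigma]
    simp
  have h3 : ∑ p ∈ (closedSets x U par (n + 2)).sigma (fun D => (childless par D).offDiag),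
      (((max ((childless par p.1).card - 2) 1 : ℕ) : ℚ)⁻¹) ^ 2 ≤
      6 * (closedSets x U par (n + 2)).card := by
    rw [Finset.sum_sigma, mul_comm, ← nsmul_eq_mul]
    refine Finset.sum_le_card_nsmul _ _ _ fun D _ => ?_
    dsimp only
    rw [Finset.sum_const]
    rw [nsmul_eq_mul, Finset.offDiag_card]
    exact pairs_le_six _
  rw [h2]
  refine le_trans ?_ h3
  refine sum_le_sum_of_injOn (e := fun p => ⟨insert p.2.2 (insert p.2.1 p.1), p.2⟩) ?_ ?_ ?_ ?_
  · rintro ⟨R, u, u'⟩ h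
    rw [Finset.mem_sigma, Finset.mem_offDiag] at h
    rw [Finset.mem_sigma, Finset.mem_offDiag]
    obtain ⟨f1, f2, f3, -, -⟩ := insert_insert_facts hx h.1 h.2.1 h.2.2.1 h.2.2.2
    exact ⟨f1, f2, f3, h.2.2.2⟩
  · rintro ⟨R, u, u'⟩ h ⟨R', v, v'⟩ h' heq
    simp only [Finset.coe_sigma, Set.mem_sigma_iff, Finset.mem_coe, Finset.mem_offDiag] at h h'
    simp only [Sigma.mk.injEq, heq_eq_eq, Prod.mk.injEq] at heq ⊢
    obtain ⟨h1, rfl, rfl⟩ := heq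
    refine ⟨?_, rfl, rfl⟩
    rw [← (insert_insert_facts hx h.1 h.2.1 h.2.2.1 h.2.2.2).2.2.2.1, h1,
      (insert_insert_facts hx h'.1 h'.2.1 h'.2.2.1 h'.2.2.2).2.2.2.1]
  · rintro ⟨R, u, u'⟩ h
    rw [Finset.mem_sigma, Finset.mem_offDiag] at h
    obtain ⟨-, -, -, -, f5⟩ := insert_insert_facts hx h.1 h.2.1 h.2.2.1 h.2.2.2
    unfold leafWeight
    have hp : (0 : ℚ) < ((max ((childless par (insert u' (insert u R))).card - 2) 1 : ℕ) : ℚ) := by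
      exact_mod_cast lt_of_lt_of_le one_pos (le_max_right _ _)
    refine pow_le_pow_left₀ (by positivity) (inv_anti₀ hp ?_) 2
    have : (childless par (insert u' (insert u R))).card - 2 ≤ (childless par R).card := by
      dsimp only at f5
      omega
    exact_mod_cast max_le_max_right _ this
  · intros
    positivity

theorem closedSets_sq_le {ρ : V → ℕ} (hρ : ∀ w ∈ U, ρ (par w) < ρ w) (hx : x ∉ U) (n : ℕ) :
    (closedSets x U par (n + 1)).card * (closedSets x U par (n + 1)).card ≤
      (closedSets x U par n).card * (6 * (closedSets x U par (n + 2)).card +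
        (closedSets x U par (n + 1)).card) := by
  have h1 := card_le_sum_leafWeight (x := x) (n := n) hρ
  have h2 := sum_pairs_le (par := par) (n := n) hx
  set f0 := (closedSets x U par n).card
  set f1 := (closedSets x U par (n + 1)).card
  set f2 := (closedSets x U par (n + 2)).card
  set X := ∑ R ∈ closedSets x U par n, ((addable x U par R).card : ℚ) * leafWeight par R
  have h3 : X ^ 2 ≤ f0 * ∑ R ∈ closedSets x U par n,
      (((addable x U par R).card : ℚ) * leafWeight par R) ^ 2 := sq_sum_le_card_mul_sum_sq
  have h4 : ∑ R ∈ closedSets x U par n, (((addable x U par R).card : ℚ) * leafWeight par R) ^ 2 ≤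
      6 * f2 + X := by
    refine le_trans ?_ (add_le_add_left h2 X)
    rw [← Finset.sum_add_distrib]
    refine Finset.sum_le_sum fun R _ => ?_
    set N := (addable x U par R).card with hN
    have h5 : ((addable x U par R).offDiag.card : ℚ) = (N : ℚ) ^ 2 - N := by
      rw [Finset.offDiag_card, ← hN, Nat.cast_sub (Nat.le_mul_self N)]
      push_cast
      ring
    rw [h5]
    have h6 := leafWeight_nonneg (par := par) R
    have h7 := leafWeight_le_one (par := par) R
    have h8 : (0 : ℚ) ≤ N := by positivity
    have h9 : (N : ℚ) * leafWeight par R ^ 2 ≤ N * leafWeight par R := by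
      refine mul_le_mul_of_nonneg_left ?_ h8
      nlinarith
    nlinarith
  have h5 : X ^ 2 ≤ f0 * (6 * f2 + X) := h3.trans (mul_le_mul_of_nonneg_left h4 (by positivity))
  rcases Nat.lt_or_ge f1 f0 with h6 | h6
  · calc f1 * f1 ≤ f0 * f1 := Nat.mul_le_mul_right _ h6.le
      _ ≤ _ := Nat.mul_le_mul_left _ (by omega)
  · have h7 : (f0 : ℚ) ≤ f1 := by exact_mod_cast h6
    have h8 : (0 : ℚ) ≤ f0 := by positivity
    have : (f1 : ℚ) * f1 ≤ f0 * (6 * f2 + f1) := by nlinarith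
    exact_mod_cast this

end Forest

section Rooted

variable {V : Type*} [Fintype V] {G : SimpleGraph V}

/-- The `n`-element sets `A` in the branch at `x` through `i` such that `A` together with `x`
spans a connected graph. -/
noncomputable def rootedSets (G : SimpleGraph V) (x i : V) (n : ℕ) : Finset (Finset V) :=
  Finset.univ.filter fun A => (∀ w ∈ A, w ∈ branchSet G x i) ∧ Conn G (insert x A) ∧ A.card = n

lemma mem_rootedSets {x i : V} {n : ℕ} {A : Finset V} : A ∈ rootedSets G x i n ↔
    (∀ w ∈ A, w ∈ branchSet G x i) ∧ Conn G (insert x A) ∧ A.card = n := by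
  simp [rootedSets]

lemma rootedSets_weakLC (hG : G.IsTree) (x i : V) :
    WeakLC fun n => (rootedSets G x i n).card := by
  have hex : ∀ w : V, w ≠ x → ∃ j, G.Adj w j ∧ x ∈ branchSet G w j := fun w hw =>
    exists_mem_branchSet hG.1 hw.symm
  let par : V → V := fun w => if h : w ≠ x then (hex w h).choose else w
  have hpar : ∀ w, w ≠ x → G.Adj w (par w) ∧ x ∈ branchSet G w (par w) := by
    intro w hw
    simp only [par, dif_pos hw]
    exact (hex w hw).choose_spec
  let U : Finset V := Finset.univ.filter fun w => w ∈ branchSet G x i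
  have hU : ∀ w, w ∈ U ↔ w ∈ branchSet G x i := fun w => by simp [U]
  have hUx : ∀ w ∈ U, w ≠ x := by
    rintro w hw rfl
    exact not_mem_branchSet_root ((hU _).1 hw)
  have hρ : ∀ w ∈ U, G.dist (par w) x < G.dist w x := fun w hw => by
    obtain ⟨h1, h2⟩ := hpar w (hUx w hw)
    have := dist_lt_of_mem_branchSet hG h1 h2
    omega
  have hx : x ∉ U := fun h => not_mem_branchSet_root ((hU _).1 h)
  have heq : ∀ n, closedSets x U par n = rootedSets G x i n := by
    intro n
    ext A
    rw [mem_closedSets, mem_rootedSets, conn_iff hG (Finset.mem_insert_self x A), ← and_assoc]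
    refine and_congr_left fun _ => ?_
    have h1 : A ⊆ U ↔ ∀ w ∈ A, w ∈ branchSet G x i :=
      ⟨fun h w hw => (hU w).1 (h hw), fun h w hw => (hU w).2 (h w hw)⟩
    rw [h1]
    refine and_congr_right fun hA => ?_
    constructor
    · intro h w hw j hj hxj
      rcases Finset.mem_insert.1 hw with rfl | hw
      · exact absurd hxj not_mem_branchSet_root
      · obtain ⟨h2, h3⟩ := hpar w (hUx w ((hU w).2 (hA w hw)))
        rw [branchSet_inj hG.2 hj h2 hxj h3]
        exact h w hw
    · intro h w hw
      obtain ⟨h2, h3⟩ := hpar w (hUx w ((hU w).2 (hA w hw)))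
      exact h w (Finset.mem_insert_of_mem hw) _ h2 h3
  refine weakLC_of_sq_le fun n _ => ?_
  have := closedSets_sq_le (x := x) (par := par) (ρ := fun w => G.dist w x) hρ hx n
  simpa only [heq] using this

end Rooted

section Ext

variable {V : Type*} [Fintype V] {G : SimpleGraph V}

lemma exists_extPt (hG : G.IsTree) {ζ : V} {r : Finset V} (hr : r.Nonempty) (hζ : ζ ∉ r) :
    ∃ p, p ∉ r ∧ (∃ q ∈ r, G.Adj p q) ∧ ∀ w ∈ r, G.dist ζ p < G.dist ζ w := by
  obtain ⟨q, hq, hmin⟩ := r.exists_min_image (G.dist ζ) hr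
  have hne : ζ ≠ q := by rintro rfl; exact hζ hq
  obtain ⟨p, hp, hζp⟩ := exists_mem_branchSet hG.1 hne
  have h1 := dist_lt_of_mem_branchSet hG hp hζp
  rw [dist_comm, dist_comm (u := q)] at h1
  have h2 : ∀ w ∈ r, G.dist ζ p < G.dist ζ w := fun w hw => by
    have := hmin w hw
    omega
  exact ⟨p, fun h => lt_irrefl _ (h2 p h), ⟨q, hq, hp.symm⟩, h2⟩

/-- The set `r` together with the next vertex on the way towards `ζ`. -/
noncomputable def ext (G : SimpleGraph V) (ζ : V) (r : Finset V) : Finset V :=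
  if h : ∃ p, p ∉ r ∧ (∃ q ∈ r, G.Adj p q) ∧ ∀ w ∈ r, G.dist ζ p < G.dist ζ w then
    insert h.choose r
  else r

/-- `r` is connected and has distance at least `m` from `ζ`. -/
def FarFrom (G : SimpleGraph V) (ζ : V) (m : ℕ) (r : Finset V) : Prop :=
  Conn G r ∧ ∀ w ∈ r, m ≤ G.dist ζ w

lemma FarFrom.mono {ζ : V} {m m' : ℕ} (h : m' ≤ m) {r : Finset V} (hr : FarFrom G ζ m r) :
    FarFrom G ζ m' r := ⟨hr.1, fun w hw => h.trans (hr.2 w hw)⟩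

lemma FarFrom.exists_ext (hG : G.IsTree) {ζ : V} {m : ℕ} {r : Finset V}
    (hr : FarFrom G ζ (m + 1) r) :
    ∃ p, ext G ζ r = insert p r ∧ p ∉ r ∧ (∃ q ∈ r, G.Adj p q) ∧
      ∀ w ∈ r, G.dist ζ p < G.dist ζ w := by
  have hζ : ζ ∉ r := fun h => by
    have := hr.2 ζ h
    simp at this
  have h := exists_extPt hG hr.1.nonempty hζ
  exact ⟨h.choose, by rw [ext, dif_pos h], h.choose_spec⟩

lemma FarFrom.ext (hG : G.IsTree) {ζ : V} {m : ℕ} {r : Finset V}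
    (hr : FarFrom G ζ (m + 1) r) : FarFrom G ζ m (ext G ζ r) := by
  obtain ⟨p, h1, -, ⟨q, hq, hpq⟩, -⟩ := hr.exists_ext hG
  rw [h1]
  refine ⟨hr.1.insert hG hq hpq, fun w hw => ?_⟩
  rcases Finset.mem_insert.1 hw with rfl | hw
  · have h2 := hr.2 q hq
    have h3 := hG.1.dist_triangle (u := ζ) (v := w) (w := q)
    have h4 := dist_eq_one_iff_adj.2 hpq
    omega
  · have := hr.2 w hw
    omega

lemma ext_injOn (hG : G.IsTree) {ζ : V} {m m' : ℕ} {r r' : Finset V}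
    (hr : FarFrom G ζ (m + 1) r) (hr' : FarFrom G ζ (m' + 1) r')
    (h : TreeDensity.ext G ζ r = TreeDensity.ext G ζ r') : r = r' := by
  obtain ⟨p, h1, h2, -, h3⟩ := hr.exists_ext hG
  obtain ⟨p', h1', h2', -, h3'⟩ := hr'.exists_ext hG
  rw [h1, h1'] at h
  have hp : p = p' := by
    by_contra hne
    have h4 : p ∈ insert p' r' := h ▸ Finset.mem_insert_self p r
    have h5 : p' ∈ insert p r := h ▸ Finset.mem_insert_self p' r'
    have h6 := h3' p ((Finset.mem_insert.1 h4).resolve_left hne)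
    have h7 := h3 p' ((Finset.mem_insert.1 h5).resolve_left (Ne.symm hne))
    omega
  subst hp
  rw [← Finset.erase_insert h2, h, Finset.erase_insert h2']

lemma FarFrom.iterate (hG : G.IsTree) {ζ : V} {e m : ℕ} {r : Finset V}
    (hr : FarFrom G ζ (m + e) r) : FarFrom G ζ m ((TreeDensity.ext G ζ)^[e] r) := by
  induction e generalizing r with
  | zero => exact hr
  | succ e ih =>
    rw [Function.iterate_succ_apply]
    exact ih (FarFrom.ext hG hr)

lemma iterate_ext_injOn (hG : G.IsTree) {ζ : V} {e : ℕ} {r r' : Finset V}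
    (hr : FarFrom G ζ e r) (hr' : FarFrom G ζ e r')
    (h : (TreeDensity.ext G ζ)^[e] r = (TreeDensity.ext G ζ)^[e] r') : r = r' := by
  induction e generalizing r r' with
  | zero => exact h
  | succ e ih =>
    rw [Function.iterate_succ_apply, Function.iterate_succ_apply] at h
    exact ext_injOn hG hr hr' (ih (FarFrom.ext hG hr) (FarFrom.ext hG hr') h)

lemma FarFrom.iterate_spec (hG : G.IsTree) {ζ x z : V} (hz : G.Adj x z)
    (hζ : ζ ∈ branchSet G x z) {e : ℕ} {r : Finset V} (hx : x ∈ r) (hr : FarFrom G ζ e r) :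
    r ⊆ (TreeDensity.ext G ζ)^[e] r ∧ ((TreeDensity.ext G ζ)^[e] r).card = r.card + e ∧
      ∀ w ∈ (TreeDensity.ext G ζ)^[e] r, w ∉ r → w ∈ branchSet G x z := by
  induction e generalizing r with
  | zero => exact ⟨subset_rfl, rfl, fun w h h' => absurd h h'⟩
  | succ e ih =>
    obtain ⟨p, h1, h2, -, h3⟩ := hr.exists_ext hG
    have h4 := FarFrom.ext hG hr
    rw [Function.iterate_succ_apply]
    rw [h1] at h4 ⊢
    obtain ⟨i1, i2, i3⟩ := ih (Finset.mem_insert_of_mem hx) h4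
    refine ⟨(Finset.subset_insert _ _).trans i1, ?_, fun w hw hwr => ?_⟩
    · rw [i2, Finset.card_insert_of_notMem h2]
      ring
    · by_cases hwp : w = p
      · subst hwp
        by_contra hwz
        have := dist_lt_of_separated hG.1 hwz hζ (by rintro rfl; exact h2 hx)
        have := h3 x hx
        omega
      · exact i3 w hw (by simp [hwp, hwr])

/-- The effect of extending towards `ζ` on the branch sizes at `x`. -/
lemma FarFrom.brCard_iterate (hG : G.IsTree) {ζ x z : V} (hz : G.Adj x z)
    (hζ : ζ ∈ branchSet G x z) {e : ℕ} {r : Finset V} (hx : x ∈ r) (hr : FarFrom G ζ e r) (l : V) :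
    brCard G ((TreeDensity.ext G ζ)^[e] r) x l = brCard G r x l + if l = z then e else 0 := by
  obtain ⟨h1, h2, h3⟩ := hr.iterate_spec hG hz hζ hx
  set s := (TreeDensity.ext G ζ)^[e] r
  split_ifs with hl
  · subst hl
    rw [brCard_of_adj hz, brCard_of_adj hz]
    have h4 : part G s x l = part G r x l ∪ (s \ r) := by
      ext w
      simp only [mem_part, Finset.mem_union, Finset.mem_sdiff]
      constructor
      · rintro ⟨hw, hb⟩
        by_cases hwr : w ∈ r <;> tauto
      · rintro (⟨hw, hb⟩ | ⟨hw, hwr⟩)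
        · exact ⟨h1 hw, hb⟩
        · exact ⟨hw, h3 w hw hwr⟩
    rw [h4, Finset.card_union_of_disjoint, Finset.card_sdiff_of_subset h1]
    · omega
    · rw [Finset.disjoint_left]
      intro w hw hw'
      exact (Finset.mem_sdiff.1 hw').2 (mem_part.1 hw).1
  · by_cases hxl : G.Adj x l
    · rw [add_zero]
      refine brCard_congr fun w hw => ⟨fun hws => ?_, fun hwr => h1 hwr⟩
      by_contra hwr
      exact hl (branchSet_inj hG.2 hxl hz hw (h3 w hws hwr))
    · simp [brCard, hxl]

lemma farFrom_of_dist {ζ x : V} {m : ℕ} {r : Finset V} (hG : G.IsTree) (hr : Conn G r)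
    (hx : x ∈ r) (h : r.card + m ≤ G.dist x ζ) : FarFrom G ζ m r := by
  refine ⟨hr, fun w hw => ?_⟩
  have h1 := hr.dist_lt_card hx hw
  have h2 := hG.1.dist_triangle (u := x) (v := w) (w := ζ)
  rw [dist_comm (u := w)] at h2
  omega

end Ext

section Median

variable {V : Type*} [Fintype V] {G : SimpleGraph V}

lemma brCard_add_three_lt (hG : G.IsTree) {r : Finset V} {x i j l : V} (hx : x ∈ r)
    (hij : i ≠ j) (hil : i ≠ l) (hjl : j ≠ l) :
    brCard G r x i + brCard G r x j + brCard G r x l < r.card := by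
  have h1 := sum_brCard hG hx
  have h2 : ∑ u ∈ ({i, j, l} : Finset V), brCard G r x u ≤ ∑ u, brCard G r x u :=
    Finset.sum_le_sum_of_subset (Finset.subset_univ _)
  rw [Finset.sum_insert (by simp [hij, hil]), Finset.sum_pair hjl] at h2
  omega

lemma three_le_brNum {r : Finset V} {x i j l : V} {P : ℕ → Prop}
    (hij : i ≠ j) (hil : i ≠ l) (hjl : j ≠ l)
    (hi : P (brCard G r x i)) (hj : P (brCard G r x j)) (hl : P (brCard G r x l)) :
    3 ≤ brNum G r x P := by
  have h : ({i, j, l} : Finset V) ⊆ Finset.univ.filter fun l => P (brCard G r x l) := by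
    intro u hu
    simp only [Finset.mem_insert, Finset.mem_singleton] at hu
    rcases hu with rfl | rfl | rfl <;> simpa
  have := Finset.card_le_card h
  rwa [Finset.card_eq_three.2 ⟨i, j, l, hij, hil, hjl, rfl⟩] at this

/-- If `x` and `y` see each other through `i` and `j`, then everything not in the branch at `y`
through `j` lies in the branch at `x` through `i`. -/
lemma compl_le_brCard (hG : G.IsTree) {r : Finset V} {x y i j : V} (hi : G.Adj x i)
    (hj : G.Adj y j) (hy : y ∈ branchSet G x i) (hx : x ∈ branchSet G y j) :
    (r.filter (· ∉ branchSet G y j)).card ≤ brCard G r x i := by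
  rw [brCard_of_adj hi]
  refine Finset.card_le_card fun w hw => ?_
  rw [Finset.mem_filter] at hw
  exact mem_part.2 ⟨hw.1, mem_branchSet_of_notMem hG hj hx hy hw.2⟩

lemma brCard_lt_of_notMem {r : Finset V} {x y i j : V} (hi : G.Adj x i)
    (hyr : y ∈ r) (hy : y ∈ branchSet G x i) (hx : x ∉ branchSet G y j) :
    brCard G r y j < brCard G r x i := by
  by_cases hj : G.Adj y j
  · rw [brCard_of_adj hi, brCard_of_adj hj]
    refine Finset.card_lt_card ⟨fun w hw => ?_, fun h => ?_⟩
    · rw [mem_part] at hw ⊢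
      exact ⟨hw.1, branchSet_subset hy hj hx hw.2⟩
    · exact not_mem_branchSet_root (mem_part.1 (h (mem_part.2 ⟨hyr, hy⟩))).2
  · have : brCard G r y j = 0 := by simp [brCard, hj]
    rw [this, brCard_of_adj hi]
    exact Finset.card_pos.2 ⟨y, mem_part.2 ⟨hyr, hy⟩⟩

lemma brCard_add_add_lt_of_notMem (hG : G.IsTree) {r : Finset V} {x y i j j' : V}
    (hi : G.Adj x i) (hyr : y ∈ r) (hy : y ∈ branchSet G x i) (hj : G.Adj y j) (hj' : G.Adj y j')
    (hjj : j ≠ j') (hx : x ∉ branchSet G y j) (hx' : x ∉ branchSet G y j') :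
    brCard G r y j + brCard G r y j' < brCard G r x i := by
  rw [brCard_of_adj hi, brCard_of_adj hj, brCard_of_adj hj',
    ← Finset.card_union_of_disjoint (part_disjoint hG r hj hj' hjj)]
  refine Finset.card_lt_card ⟨fun w hw => ?_, fun h => ?_⟩
  · simp only [Finset.mem_union, mem_part] at hw ⊢
    rcases hw with hw | hw
    · exact ⟨hw.1, branchSet_subset hy hj hx hw.2⟩
    · exact ⟨hw.1, branchSet_subset hy hj' hx' hw.2⟩
  · have := h (mem_part.2 ⟨hyr, hy⟩)
    rw [Finset.mem_union, mem_part, mem_part] at this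
    rcases this with h | h <;> exact not_mem_branchSet_root h.2

lemma mutual_of_bounds (hG : G.IsTree) {r : Finset V} {x y i j : V}
    (hxy : x ≠ y) (hi : G.Adj x i) (hj : G.Adj y j)
    (h1 : ∀ i', i' ≠ i → brCard G r x i' + brCard G r y j < r.card)
    (h2 : ∀ j', j' ≠ j → brCard G r y j' + brCard G r x i < r.card)
    (h3 : ∀ i' j', i' ≠ i → j' ≠ j → G.Adj x i' → G.Adj y j' → y ∈ branchSet G x i' →
      x ∈ branchSet G y j' → False) : y ∈ branchSet G x i ∧ x ∈ branchSet G y j := by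
  obtain ⟨i', hi', hy⟩ := exists_mem_branchSet hG.1 hxy.symm
  obtain ⟨j', hj', hx⟩ := exists_mem_branchSet hG.1 hxy
  by_cases hii : i' = i
  · subst hii
    refine ⟨hy, ?_⟩
    by_cases hjj : j' = j
    · exact hjj ▸ hx
    · have h4 := compl_le_brCard (r := r) hG hj' hi' hx hy
      have h5 := brCard_add_compl r hi'
      have h6 := h2 j' hjj
      omega
  · by_cases hjj : j' = j
    · subst hjj
      have h4 := compl_le_brCard (r := r) hG hi' hj' hy hx
      have h5 := brCard_add_compl r hj'
      have h6 := h1 i' hii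
      omega
    · exact (h3 i' j' hii hjj hi' hj' hy hx).elim

lemma exists_median (hG : G.IsTree) {r : Finset V} (hr : Conn G r) {x y z i j l : V}
    (hxr : x ∈ r) (hyr : y ∈ r) (hzr : z ∈ r) (hi : G.Adj x i) (hj : G.Adj y j) (hl : G.Adj z l)
    (hxy : y ∈ branchSet G x i) (hxz : z ∈ branchSet G x i)
    (hyx : x ∈ branchSet G y j) (hyz : z ∈ branchSet G y j)
    (hzx : x ∈ branchSet G z l) (hzy : y ∈ branchSet G z l) :
    ∃ m ∈ r, ∃ a b c, G.Adj m a ∧ G.Adj m b ∧ G.Adj m c ∧ a ≠ b ∧ a ≠ c ∧ b ≠ c ∧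
      x ∈ branchSet G m a ∧ y ∈ branchSet G m b ∧ z ∈ branchSet G m c ∧
      m ∈ branchSet G x i ∧ m ∈ branchSet G y j ∧ m ∈ branchSet G z l := by
  obtain ⟨m, -, hmin⟩ := (Finset.univ : Finset V).exists_min_image
    (fun m => G.dist m x + G.dist m y + G.dist m z) ⟨x, Finset.mem_univ _⟩
  have hsep : ∀ n, G.Adj m n → ∀ u v w, (u = x ∧ v = y ∧ w = z ∨ u = x ∧ v = z ∧ w = y ∨
      u = y ∧ v = z ∧ w = x) → u ∈ branchSet G m n → v ∈ branchSet G m n → False := by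
    intro n hn u v w huvw hu hv
    have h1 := dist_lt_of_mem_branchSet hG hn hu
    have h2 := dist_lt_of_mem_branchSet hG hn hv
    have h3 := hG.1.dist_triangle (u := n) (v := m) (w := w)
    have h4 := dist_eq_one_iff_adj.2 hn.symm
    have h5 := hmin n (Finset.mem_univ _)
    rcases huvw with ⟨rfl, rfl, rfl⟩ | ⟨rfl, rfl, rfl⟩ | ⟨rfl, rfl, rfl⟩ <;> omega
  have hmx : x ≠ m := by
    rintro rfl
    exact hsep i hi y z x (by tauto) hxy hxz
  have hmy : y ≠ m := by
    rintro rfl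
    exact hsep j hj x z y (by tauto) hyx hyz
  have hmz : z ≠ m := by
    rintro rfl
    exact hsep l hl x y z (by tauto) hzx hzy
  obtain ⟨a, ha, hxa⟩ := exists_mem_branchSet hG.1 hmx
  obtain ⟨b, hb, hyb⟩ := exists_mem_branchSet hG.1 hmy
  obtain ⟨c, hc, hzc⟩ := exists_mem_branchSet hG.1 hmz
  have hab : a ≠ b := by
    rintro rfl
    exact hsep a ha x y z (by tauto) hxa hyb
  have hac : a ≠ c := by
    rintro rfl
    exact hsep a ha x z y (by tauto) hxa hzc
  have hbc : b ≠ c := by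
    rintro rfl
    exact hsep b hb y z x (by tauto) hyb hzc
  have key : ∀ {u v p a b : V}, G.Adj u p → v ∈ branchSet G u p → m ≠ u → G.Adj m a → G.Adj m b →
      a ≠ b → u ∈ branchSet G m a → v ∈ branchSet G m b → m ∈ branchSet G u p := by
    intro u v p a b hp hv hmu ha hb hab hua hvb
    obtain ⟨p', hp', hm⟩ := exists_mem_branchSet hG.1 hmu
    have h1 := branchSet_subset hm hb (fun h => hab (branchSet_inj hG.2 ha hb hua h)) hvb
    exact branchSet_inj hG.2 hp hp' hv h1 ▸ hm
  refine ⟨m, ?_, a, b, c, ha, hb, hc, hab, hac, hbc, hxa, hyb, hzc,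
    key hi hxy hmx.symm ha hb hab hxa hyb, key hj hyx hmy.symm hb ha hab.symm hyb hxa,
    key hl hzx hmz.symm hc ha hac.symm hzc hxa⟩
  by_contra hm
  exact hab (branchSet_inj hG.2 ha hb (hr.same_branch hm hxr hyr hxa) hyb)

/-- At `x`, the branch through `i` meets `r` in `c` vertices, no branch meets `r` in more than
`c + 1` vertices, and two further branches meet `r`. -/
structure IsNode (G : SimpleGraph V) (k c : ℕ) (r : Finset V) (x i : V) : Prop where
  mem : x ∈ r
  adj : G.Adj x i
  card_eq : brCard G r x i = c
  card_le : ∀ l, brCard G r x l ≤ c + 1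
  others : ∃ l l', l ≠ l' ∧ l ≠ i ∧ l' ≠ i ∧ 1 ≤ brCard G r x l ∧ 1 ≤ brCard G r x l'
  hub : HubCond G k r x i

lemma IsNode.exists_other {k c : ℕ} {r : Finset V} {x i : V} (h : IsNode G k c r x i) (u : V) :
    ∃ l, l ≠ i ∧ l ≠ u ∧ 1 ≤ brCard G r x l := by
  obtain ⟨l, l', h1, h2, h3, h4, h5⟩ := h.others
  by_cases hl : l = u
  · exact ⟨l', h3, by rintro rfl; exact h1 hl, h5⟩
  · exact ⟨l, h2, hl, h4⟩

lemma IsNode.mutual (hG : G.IsTree) {k c : ℕ} {r : Finset V} {x y i j : V}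
    (hx : IsNode G k c r x i) (hy : IsNode G k c r y j) (hxy : x ≠ y) :
    y ∈ branchSet G x i ∧ x ∈ branchSet G y j := by
  have aux : ∀ {x i}, IsNode G k c r x i → ∀ i', i' ≠ i → brCard G r x i' + c < r.card := by
    intro x i hx i' hi'
    obtain ⟨l, h1, h2, h3⟩ := hx.exists_other i'
    have := brCard_add_three_lt hG hx.mem hi' h2.symm h1.symm
    have := hx.card_eq
    omega
  refine mutual_of_bounds (r := r) hG hxy hx.adj hy.adj ?_ ?_ ?_
  · rw [hy.card_eq]
    exact aux hx
  · rw [hx.card_eq]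
    exact aux hy
  · intro i' j' hi' hj' hai haj hyi hxj
    obtain ⟨l, h1, h2, h3⟩ := hy.exists_other j'
    have hl := adj_of_brCard_pos h3
    have h4 := brCard_add_add_lt_of_notMem (r := r) hG hai hy.mem hyi hy.adj hl h1.symm
      (fun h => hj' (branchSet_inj hG.2 haj hy.adj hxj h))
      (fun h => h2 (branchSet_inj hG.2 hl haj h hxj))
    have h5 := hx.card_le i'
    have h6 := hy.card_eq
    omega

lemma HubCond.compl_le {k : ℕ} {r : Finset V} {x i m a : V} (h : HubCond G k r x i) (hm : m ∈ r)
    (hmi : m ∈ branchSet G x i) (ha : G.Adj m a) (hxa : x ∈ branchSet G m a)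
    (h3 : 3 ≤ brNum G r m (2 ≤ ·)) : 2 * (r.filter (· ∉ branchSet G m a)).card ≤ k := by
  by_contra! hlt
  exact h m hm hmi a ha hxa hlt h3

/-- A nearly full set has at most two nodes. -/
lemma IsNode.not_three (hG : G.IsTree) {k c : ℕ} (hk : 7 ≤ k) {r : Finset V} (hr : Conn G r)
    (hcard : k ≤ r.card + 2) {x y z i j l : V} (hx : IsNode G k c r x i)
    (hy : IsNode G k c r y j) (hz : IsNode G k c r z l) (hxy : x ≠ y) (hxz : x ≠ z)
    (hyz : y ≠ z) : False := by
  obtain ⟨m, hm, a, b, d, ha, hb, hd, hab, had, hbd, hxa, hyb, hzd, hmx, hmy, hmz⟩ :=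
    exists_median hG hr hx.mem hy.mem hz.mem hx.adj hy.adj hz.adj
      (hx.mutual hG hy hxy).1 (hx.mutual hG hz hxz).1 (hx.mutual hG hy hxy).2
      (hy.mutual hG hz hyz).1 (hx.mutual hG hz hxz).2 (hy.mutual hG hz hyz).2
  have aux : ∀ {x i a}, IsNode G k c r x i → G.Adj m a → x ∈ branchSet G m a →
      m ∈ branchSet G x i → 2 ≤ brCard G r m a := by
    intro x i a hx ha hxa hmx
    have h1 := compl_le_brCard (r := r) hG ha hx.adj hxa hmx
    have h2 := brCard_add_compl r hx.adj
    obtain ⟨l, l', h3, h4, h5, h6, h7⟩ := hx.others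
    have h8 := brCard_add_three_lt hG hx.mem h3 h4 h5
    omega
  have hRT : 3 ≤ brNum G r m (2 ≤ ·) := three_le_brNum hab had hbd
    (aux hx ha hxa hmx) (aux hy hb hyb hmy) (aux hz hd hzd hmz)
  have h1 := hx.hub.compl_le hm hmx ha hxa hRT
  have h2 := hy.hub.compl_le hm hmy hb hyb hRT
  have h3 := hz.hub.compl_le hm hmz hd hzd hRT
  have h4 := brCard_add_compl r ha
  have h5 := brCard_add_compl r hb
  have h6 := brCard_add_compl r hd
  have h7 := brCard_add_three_lt hG hm hab had hbd
  omega

end Median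

section Agree

variable {V : Type*} [Fintype V] {G : SimpleGraph V} {r s : Finset V} {x i : V}

lemma filter_compl_eq_of_agree (hG : G.IsTree) (h : ∀ w ∈ branchSet G x i, w ∈ r ↔ w ∈ s)
    {w j : V} (hw : w ∈ branchSet G x i) (hj : G.Adj w j)
    (hx : x ∈ branchSet G w j) :
    r.filter (· ∉ branchSet G w j) = s.filter (· ∉ branchSet G w j) := by
  ext v
  simp only [Finset.mem_filter]
  refine and_congr_left fun hv => h v ?_
  exact mem_branchSet_of_notMem hG hj hx hw hv

lemma brCard_eq_of_agree (h : ∀ w ∈ branchSet G x i, w ∈ r ↔ w ∈ s)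
    {w l : V} (hw : w ∈ branchSet G x i) (hx : x ∉ branchSet G w l) :
    brCard G r w l = brCard G s w l := by
  by_cases hl : G.Adj w l
  · exact brCard_congr fun v hv => h v (branchSet_subset hw hl hx hv)
  · simp [brCard, hl]

lemma brCard_eq_of_agree_of_card (hG : G.IsTree) (h : ∀ w ∈ branchSet G x i, w ∈ r ↔ w ∈ s)
    (hcard : r.card = s.card) {w : V} (hw : w ∈ branchSet G x i) (l : V) :
    brCard G r w l = brCard G s w l := by
  by_cases hx : x ∈ branchSet G w l
  · by_cases hl : G.Adj w l
    · have h1 := filter_compl_eq_of_agree hG h hw hl hx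
      have h2 := brCard_add_compl r hl
      have h3 := brCard_add_compl s hl
      rw [h1] at h2
      omega
    · simp [brCard, hl]
  · exact brCard_eq_of_agree h hw hx

/-- If `s` contains `x` and a neighbour of `x` outside of the branch through `i`, then the branch
towards `x` at a vertex inside that branch has at least two vertices in `s`. -/
lemma two_le_brCard (hG : G.IsTree) (hi : G.Adj x i) {u : V} (hu : G.Adj x u)
    (hui : u ≠ i) (hxs : x ∈ s) (hus : u ∈ s) {w l : V} (hw : w ∈ branchSet G x i)
    (hl : G.Adj w l) (hx : x ∈ branchSet G w l) : 2 ≤ brCard G s w l := by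
  rw [brCard_of_adj hl, ← Finset.card_pair hu.ne]
  have hu' : u ∉ branchSet G x i := fun h =>
    hui (branchSet_inj hG.2 hu hi (mem_branchSet_self hu.ne) h)
  refine Finset.card_le_card fun v hv => ?_
  simp only [Finset.mem_insert, Finset.mem_singleton] at hv
  rcases hv with rfl | rfl
  · exact mem_part.2 ⟨hxs, hx⟩
  · exact mem_part.2 ⟨hus, mem_branchSet_of_notMem hG hi hw hx hu'⟩

lemma HubCond.of_agree (hG : G.IsTree) {k : ℕ} (hs : HubCond G k s x i)
    (h : ∀ w ∈ branchSet G x i, w ∈ r ↔ w ∈ s) (hi : G.Adj x i) {u : V} (hu : G.Adj x u)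
    (hui : u ≠ i) (hxs : x ∈ s) (hus : u ∈ s) : HubCond G k r x i := by
  intro w hwr hw j hj hx hk h3
  rw [filter_compl_eq_of_agree hG h hw hj hx] at hk
  refine hs w ((h w hw).1 hwr) hw j hj hx hk (h3.trans ?_)
  refine Finset.card_le_card fun l hl => ?_
  simp only [Finset.mem_filter, Finset.mem_univ, true_and] at hl ⊢
  by_cases hxl : x ∈ branchSet G w l
  · exact two_le_brCard hG hi hu hui hxs hus hw (adj_of_brCard_pos (lt_of_lt_of_le two_pos hl)) hxl
  · rwa [← brCard_eq_of_agree h hw hxl]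

end Agree

section NotCopy

variable {V W : Type*} [Fintype V] [Fintype W] {T : SimpleGraph V} {S : SimpleGraph W}

lemma not_isCopy_of_brSq_ne (hS : S.IsTree) (hT : T.IsTree) {r s : Finset V} {x i : V} {c q : ℕ}
    {φ : W → V} (hφ : IsCopy S T s φ)
    (h : ∀ w ∈ branchSet T x i, w ∈ r ↔ w ∈ s) (hxr : x ∈ r) (hxs : x ∈ s)
    (hcard : r.card = s.card) (hc : brCard T s x i = c) (hle : ∀ l, brCard T s x l ≤ c)
    (hq : brSq T s x = q) (hne : brSq T r x ≠ q) : ¬ ∃ ψ, IsCopy S T r ψ := by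
  rintro ⟨ψ, hψ⟩
  have key : ∀ {s : Finset V} {φ : W → V}, IsCopy S T s φ →
      (s.filter fun y => (∀ l, brCard T s y l ≤ c) ∧ brSq T s y = q).card =
      (Finset.univ.filter fun v =>
        (∀ u, brCard S Finset.univ v u ≤ c) ∧ brSq S Finset.univ v = q).card := by
    intro s φ hφ
    rw [hφ.filter_card]
    simp only [hφ.brCard_le_iff hS hT, hφ.brSq_eq hS hT]
  have h1 := (key hψ).trans (key hφ).symm
  refine (Finset.card_lt_card ⟨fun y hy => ?_, fun hsub => ?_⟩).ne h1
  · rw [Finset.mem_filter] at hy ⊢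
    obtain ⟨hyr, hyc, hyq⟩ := hy
    have hyx : x ≠ y := by rintro rfl; exact hne hyq
    have hyi : y ∈ branchSet T x i := by
      by_contra hyi
      obtain ⟨j, hj, hxj⟩ := exists_mem_branchSet hT.1 hyx
      have h2 := brCard_lt_of_notMem (r := r) hj hxr hxj hyi
      have h3 := hyc j
      rw [brCard_congr h, hc] at h2
      omega
    have h4 := brCard_eq_of_agree_of_card hT h hcard hyi
    refine ⟨(h y hyi).1 hyr, fun l => h4 l ▸ hyc l, ?_⟩
    rw [← hyq]
    simp only [brSq, h4]
  · have := hsub (Finset.mem_filter.2 ⟨hxs, hle, hq⟩)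
    exact hne (Finset.mem_filter.1 this).2.2

end NotCopy

section Swap

variable {V : Type*} [Fintype V] {G : SimpleGraph V}

lemma Conn.union (hG : G.IsTree) {s s' : Finset V} (hs : Conn G s) (hs' : Conn G s') {x : V}
    (hx : x ∈ s) (hx' : x ∈ s') : Conn G (s ∪ s') := by
  rw [conn_iff hG hx] at hs
  rw [conn_iff hG hx'] at hs'
  rw [conn_iff hG (Finset.mem_union_left _ hx)]
  intro w hw j hj hxj
  rw [Finset.mem_union] at hw ⊢
  rcases hw with hw | hw
  · exact Or.inl (hs w hw j hj hxj)
  · exact Or.inr (hs' w hw j hj hxj)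

/-- The part of `s` outside of the branches at `x` through `i` and `j`. -/
noncomputable def rest (G : SimpleGraph V) (s : Finset V) (x i j : V) : Finset V :=
  s.filter fun w => w ∉ branchSet G x i ∧ w ∉ branchSet G x j

lemma mem_rest {s : Finset V} {x i j w : V} : w ∈ rest G s x i j ↔
    w ∈ s ∧ w ∉ branchSet G x i ∧ w ∉ branchSet G x j := by
  simp [rest]

lemma rest_mem_self {s : Finset V} {x i j : V} (hx : x ∈ s) : x ∈ rest G s x i j :=
  mem_rest.2 ⟨hx, not_mem_branchSet_root, not_mem_branchSet_root⟩

lemma Conn.rest (hG : G.IsTree) {s : Finset V} (hs : Conn G s) {x : V} (hx : x ∈ s) (i j : V) :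
    Conn G (rest G s x i j) := by
  rw [conn_iff hG (rest_mem_self hx)]
  intro w hw u hu hxu
  rw [mem_rest] at hw ⊢
  have hwx : w ≠ x := by rintro rfl; exact not_mem_branchSet_root hxu
  exact ⟨hs.nbr_mem hG hw.1 hx hu hxu, fun h => hw.2.1 (mem_branchSet_of_adj h hu.symm hwx),
    fun h => hw.2.2 (mem_branchSet_of_adj h hu.symm hwx)⟩

lemma Conn.part_mem_rootedSets (hG : G.IsTree) {s : Finset V} (hs : Conn G s) {x : V}
    (hx : x ∈ s) {i : V} (hi : G.Adj x i) : part G s x i ∈ rootedSets G x i (brCard G s x i) := by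
  refine mem_rootedSets.2 ⟨fun w hw => (mem_part.1 hw).2, ?_, (brCard_of_adj hi).symm⟩
  rw [conn_iff hG (Finset.mem_insert_self _ _)]
  intro w hw u hu hxu
  have hwx : w ≠ x := by rintro rfl; exact not_mem_branchSet_root hxu
  have hw := mem_part.1 (Finset.mem_of_mem_insert_of_ne hw hwx)
  rw [Finset.mem_insert, mem_part]
  by_cases hux : u = x
  · exact Or.inl hux
  · exact Or.inr ⟨hs.nbr_mem hG hw.1 hx hu hxu, mem_branchSet_of_adj hw.2 hu hux⟩

/-- `R` is the outside part, and `A`, `B` are subtrees hanging at `x` through `i` and `j`. -/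
structure IsSwap (G : SimpleGraph V) (x i j : V) (R A B : Finset V) : Prop where
  conn : Conn G R
  mem : x ∈ R
  adj_left : G.Adj x i
  adj_right : G.Adj x j
  ne : i ≠ j
  out : ∀ w ∈ R, w ∉ branchSet G x i ∧ w ∉ branchSet G x j
  left : A ∈ rootedSets G x i A.card
  right : B ∈ rootedSets G x j B.card

namespace IsSwap

variable {x i j : V} {R A B : Finset V}

lemma mem_left (h : IsSwap G x i j R A B) {w : V} (hw : w ∈ A) : w ∈ branchSet G x i :=
  (mem_rootedSets.1 h.left).1 w hw

lemma mem_right (h : IsSwap G x i j R A B) {w : V} (hw : w ∈ B) : w ∈ branchSet G x j :=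
  (mem_rootedSets.1 h.right).1 w hw

lemma conn_union (hG : G.IsTree) (h : IsSwap G x i j R A B) : Conn G (R ∪ A ∪ B) := by
  have h1 := (h.conn.union hG (mem_rootedSets.1 h.left).2.1 h.mem
    (Finset.mem_insert_self _ _)).union hG (mem_rootedSets.1 h.right).2.1
    (Finset.mem_union_left _ h.mem) (Finset.mem_insert_self _ _)
  convert h1 using 1
  ext w
  have := h.mem
  simp only [Finset.mem_union, Finset.mem_insert]
  by_cases hw : w = x
  · subst hw; tauto
  · tauto

lemma notMem_of_left (hG : G.IsTree) (h : IsSwap G x i j R A B) {w : V}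
    (hw : w ∈ branchSet G x i) : w ∉ branchSet G x j := fun hw' =>
  h.ne (branchSet_inj hG.2 h.adj_left h.adj_right hw hw')

lemma part_left (hG : G.IsTree) (h : IsSwap G x i j R A B) : part G (R ∪ A ∪ B) x i = A := by
  ext w
  simp only [mem_part, Finset.mem_union]
  constructor
  · rintro ⟨(hw | hw) | hw, hi⟩
    · exact absurd hi (h.out w hw).1
    · exact hw
    · exact absurd (h.mem_right hw) (h.notMem_of_left hG hi)
  · exact fun hw => ⟨Or.inl (Or.inr hw), h.mem_left hw⟩

lemma part_right (hG : G.IsTree) (h : IsSwap G x i j R A B) : part G (R ∪ A ∪ B) x j = B := by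
  ext w
  simp only [mem_part, Finset.mem_union]
  constructor
  · rintro ⟨(hw | hw) | hw, hj⟩
    · exact absurd hj (h.out w hw).2
    · exact absurd hj (h.notMem_of_left hG (h.mem_left hw))
    · exact hw
  · exact fun hw => ⟨Or.inr hw, h.mem_right hw⟩

lemma rest_eq (h : IsSwap G x i j R A B) : rest G (R ∪ A ∪ B) x i j = R := by
  ext w
  simp only [mem_rest, Finset.mem_union]
  constructor
  · rintro ⟨(hw | hw) | hw, hj⟩
    · exact hw
    · exact absurd (h.mem_left hw) hj.1
    · exact absurd (h.mem_right hw) hj.2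
  · exact fun hw => ⟨Or.inl (Or.inl hw), h.out w hw⟩

lemma brCard_left (hG : G.IsTree) (h : IsSwap G x i j R A B) :
    brCard G (R ∪ A ∪ B) x i = A.card := by
  rw [brCard_of_adj h.adj_left, h.part_left hG]

lemma brCard_right (hG : G.IsTree) (h : IsSwap G x i j R A B) :
    brCard G (R ∪ A ∪ B) x j = B.card := by
  rw [brCard_of_adj h.adj_right, h.part_right hG]

lemma card_union (hG : G.IsTree) (h : IsSwap G x i j R A B) :
    (R ∪ A ∪ B).card = R.card + A.card + B.card := by
  rw [Finset.card_union_of_disjoint, Finset.card_union_of_disjoint]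
  · rw [Finset.disjoint_left]
    exact fun w hw hw' => (h.out w hw).1 (h.mem_left hw')
  · rw [Finset.disjoint_left]
    intro w hw hw'
    rcases Finset.mem_union.1 hw with hw | hw
    · exact (h.out w hw).2 (h.mem_right hw')
    · exact h.notMem_of_left hG (h.mem_left hw) (h.mem_right hw')

lemma mem_iff (hG : G.IsTree) (h : IsSwap G x i j R A B) {l w : V} (hli : l ≠ i) (hlj : l ≠ j)
    (hl : G.Adj x l) (hw : w ∈ branchSet G x l) : w ∈ R ∪ A ∪ B ↔ w ∈ R := by
  simp only [Finset.mem_union]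
  constructor
  · rintro ((hw' | hw') | hw')
    · exact hw'
    · exact absurd (branchSet_inj hG.2 hl h.adj_left hw (h.mem_left hw')) hli
    · exact absurd (branchSet_inj hG.2 hl h.adj_right hw (h.mem_right hw')) hlj
  · exact fun hw' => Or.inl (Or.inl hw')

lemma brCard_other (hG : G.IsTree) (h : IsSwap G x i j R A B) {l : V} (hli : l ≠ i)
    (hlj : l ≠ j) : brCard G (R ∪ A ∪ B) x l = brCard G R x l := by
  by_cases hl : G.Adj x l
  · exact brCard_congr fun w hw => h.mem_iff hG hli hlj hl hw
  · simp [brCard, hl]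

lemma brSq_eq (hG : G.IsTree) (h : IsSwap G x i j R A B) :
    brSq G (R ∪ A ∪ B) x = brSq G R x + A.card ^ 2 + B.card ^ 2 := by
  have hi : brCard G R x i = 0 := by
    rw [brCard_of_adj h.adj_left, Finset.card_eq_zero, Finset.eq_empty_iff_forall_notMem]
    exact fun w hw => (h.out w (mem_part.1 hw).1).1 (mem_part.1 hw).2
  have hj : brCard G R x j = 0 := by
    rw [brCard_of_adj h.adj_right, Finset.card_eq_zero, Finset.eq_empty_iff_forall_notMem]
    exact fun w hw => (h.out w (mem_part.1 hw).1).2 (mem_part.1 hw).2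
  have h1 : ∀ l, brCard G (R ∪ A ∪ B) x l ^ 2 = brCard G R x l ^ 2 +
      (if l = i then A.card ^ 2 else 0) + (if l = j then B.card ^ 2 else 0) := by
    intro l
    by_cases hli : l = i
    · subst hli
      rw [h.brCard_left hG, hi]
      simp [h.ne]
    · by_cases hlj : l = j
      · subst hlj
        rw [h.brCard_right hG, hj]
        simp [hli]
      · rw [h.brCard_other hG hli hlj]
        simp [hli, hlj]
  simp only [brSq, h1, Finset.sum_add_distrib, Finset.sum_ite_eq', Finset.mem_univ, if_true]

end IsSwap

lemma rest_union_parts (s : Finset V) (x i j : V) :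
    rest G s x i j ∪ part G s x i ∪ part G s x j = s := by
  ext w
  simp only [Finset.mem_union, mem_rest, mem_part]
  tauto

lemma Conn.isSwap (hG : G.IsTree) {s : Finset V} (hs : Conn G s) {x i j : V} (hx : x ∈ s)
    (hi : G.Adj x i) (hj : G.Adj x j) (hij : i ≠ j) :
    IsSwap G x i j (TreeDensity.rest G s x i j) (part G s x i) (part G s x j) where
  conn := hs.rest hG hx i j
  mem := rest_mem_self hx
  adj_left := hi
  adj_right := hj
  ne := hij
  out := fun _ hw => (mem_rest.1 hw).2
  left := by
    rw [← brCard_of_adj hi]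
    exact hs.part_mem_rootedSets hG hx hi
  right := by
    rw [← brCard_of_adj hj]
    exact hs.part_mem_rootedSets hG hx hj

end Swap

section Conf

variable {V W : Type*} [Fintype V] [Fintype W]

lemma brNum_le_add {G : SimpleGraph V} {r s : Finset V} {x : V} {P : ℕ → Prop} (F : Finset V)
    (h : ∀ l ∉ F, P (brCard G r x l) → P (brCard G s x l)) :
    brNum G r x P ≤ brNum G s x P + F.card := by
  refine (Finset.card_le_card fun l hl => ?_).trans (Finset.card_union_le _ _)
  simp only [Finset.mem_filter, Finset.mem_univ, true_and, Finset.mem_union] at hl ⊢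
  by_cases hF : l ∈ F
  · exact Or.inr hF
  · exact Or.inl (h l hF hl)

/-- The properties of a hub of `S` that are used in the counting argument. -/
structure IsRoot (S : SimpleGraph W) (k c t M n : ℕ) (v : W) : Prop where
  two_le : 2 ≤ t
  le_max : t ≤ c
  max_add_le : c + 5 ≤ k
  three_le : 3 ≤ M
  le : ∀ u, brCard S Finset.univ v u ≤ c
  num : brNum S Finset.univ v (t ≤ ·) = M
  num_le : brNum S Finset.univ v (t - 1 ≤ ·) ≤ M + 1
  num_max : brNum S Finset.univ v (· = c) = n
  pos : 1 ≤ n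
  hub : ∀ u, brCard S Finset.univ v u = c → HubCond S k Finset.univ v u

/-- A copy `s` of `S`, a vertex `x` that looks like a hub, and three branches at `x`. -/
structure IsConf (S : SimpleGraph W) (T : SimpleGraph V) (k c t M n q : ℕ) (ζ : V)
    (s : Finset V) (x u i j : V) : Prop where
  copy : ∃ φ, IsCopy S T s φ
  conn : Conn T s
  card : s.card = k
  mem : x ∈ s
  far : 2 * k ≤ T.dist x ζ
  ne_left : i ≠ u
  ne_right : j ≠ u
  ne : i ≠ j
  card_eq : brCard T s x u = c
  le : ∀ l, brCard T s x l ≤ c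
  left : t ≤ brCard T s x i
  right : t ≤ brCard T s x j
  sq : brSq T s x = q
  num_le : brNum T s x (t - 1 ≤ ·) ≤ M + 1
  num_max : brNum T s x (· = c) = n
  hub : HubCond T k s x u

/-- A connected set `r` whose extension by `e` vertices towards `ζ` is not a copy of `S`. -/
structure IsTarg (S : SimpleGraph W) (T : SimpleGraph V) (k c t M n : ℕ) (ζ : V) (e : ℕ)
    (r : Finset V) (x u i j : V) : Prop where
  conn : Conn T r
  card : r.card + e = k
  le_two : e ≤ 2
  node : IsNode T k c r x u
  far : 2 * k ≤ T.dist x ζ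
  left : t - 1 ≤ brCard T r x i
  right : t - 1 ≤ brCard T r x j
  num_le : brNum T r x (t - 1 ≤ ·) ≤ M + 1
  num_max : brNum T r x (· = c) ≤ n + 2
  not_copy : ¬ ∃ ψ, IsCopy S T ((ext T ζ)^[e] r) ψ

variable {S : SimpleGraph W} {T : SimpleGraph V} {k c t M n q : ℕ} {ζ : V} {s : Finset V}
  {x u i j : V}

namespace IsConf

variable (hT : T.IsTree) (h : IsConf S T k c t M n q ζ s x u i j)
include hT h

lemma adj (ht : 2 ≤ t) (hc : t ≤ c) : T.Adj x u ∧ T.Adj x i ∧ T.Adj x j :=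
  ⟨adj_of_brCard_pos (s := s) (by have := h.card_eq; omega),
    adj_of_brCard_pos (s := s) (by have := h.left; omega),
    adj_of_brCard_pos (s := s) (by have := h.right; omega)⟩

lemma isSwap (ht : 2 ≤ t) (hc : t ≤ c) :
    IsSwap T x i j (rest T s x i j) (part T s x i) (part T s x j) :=
  h.conn.isSwap hT h.mem (h.adj hT ht hc).2.1 (h.adj hT ht hc).2.2 h.ne

lemma brCard_rest {A B : Finset V} (hAB : IsSwap T x i j (rest T s x i j) A B) {l : V}
    (hli : l ≠ i) (hlj : l ≠ j) :
    brCard T (rest T s x i j ∪ A ∪ B) x l = brCard T s x l := by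
  have h0 := h.conn.isSwap hT h.mem hAB.adj_left hAB.adj_right h.ne
  rw [hAB.brCard_other hT hli hlj, ← h0.brCard_other hT hli hlj, rest_union_parts]

lemma brSq_rest {A B : Finset V} (hAB : IsSwap T x i j (rest T s x i j) A B) :
    brSq T (rest T s x i j ∪ A ∪ B) x + brCard T s x i ^ 2 + brCard T s x j ^ 2 =
      q + A.card ^ 2 + B.card ^ 2 := by
  have h0 := h.conn.isSwap hT h.mem hAB.adj_left hAB.adj_right h.ne
  have h1 := h0.brSq_eq hT
  rw [rest_union_parts, h.sq, ← brCard_of_adj hAB.adj_left, ← brCard_of_adj hAB.adj_right] at h1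
  rw [hAB.brSq_eq hT, h1]
  ring

lemma card_rest {A B : Finset V} (hAB : IsSwap T x i j (rest T s x i j) A B) :
    (rest T s x i j ∪ A ∪ B).card + brCard T s x i + brCard T s x j =
      k + A.card + B.card := by
  have h0 := h.conn.isSwap hT h.mem hAB.adj_left hAB.adj_right h.ne
  have h1 := h0.card_union hT
  rw [rest_union_parts, h.card, ← brCard_of_adj hAB.adj_left,
    ← brCard_of_adj hAB.adj_right] at h1
  rw [hAB.card_union hT]
  omega

lemma mem_rest_iff {A B : Finset V} (hAB : IsSwap T x i j (rest T s x i j) A B) (hu : T.Adj x u)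
    (w : V) (hw : w ∈ branchSet T x u) : w ∈ rest T s x i j ∪ A ∪ B ↔ w ∈ s := by
  have h0 := h.conn.isSwap hT h.mem hAB.adj_left hAB.adj_right h.ne
  rw [hAB.mem_iff hT h.ne_left.symm h.ne_right.symm hu hw,
    ← h0.mem_iff hT h.ne_left.symm h.ne_right.symm hu hw, rest_union_parts]

lemma isTarg (ht : 2 ≤ t) (hc : t ≤ c) {A B : Finset V} {e : ℕ}
    (hAB : IsSwap T x i j (rest T s x i j) A B) (he : e ≤ 2)
    (hsum : A.card + B.card + e = brCard T s x i + brCard T s x j)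
    (hA : A.card ≤ c + 1) (hB : B.card ≤ c + 1) (hA' : t - 1 ≤ A.card) (hB' : t - 1 ≤ B.card)
    (hn : ¬ ∃ ψ, IsCopy S T ((ext T ζ)^[e] (rest T s x i j ∪ A ∪ B)) ψ) :
    IsTarg S T k c t M n ζ e (rest T s x i j ∪ A ∪ B) x u i j := by
  have hconn := hAB.conn_union hT
  have hcard := h.card_rest hT hAB
  have hu := (h.adj hT ht hc).1
  have hi := (h.adj hT ht hc).2.1
  have hagree := h.mem_rest_iff hT hAB hu
  have hoth : ∀ l, l ≠ i → l ≠ j → brCard T (rest T s x i j ∪ A ∪ B) x l = brCard T s x l :=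
    fun l => h.brCard_rest hT hAB
  have hli := hAB.brCard_left hT
  have hlj := hAB.brCard_right hT
  have hmem : x ∈ rest T s x i j ∪ A ∪ B :=
    Finset.mem_union_left _ (Finset.mem_union_left _ hAB.mem)
  set r := rest T s x i j ∪ A ∪ B with hr
  have h1 := h.left
  have h2 := h.right
  refine ⟨hconn, by omega, he, ⟨hmem, hu, ?_, ?_, ⟨i, j, h.ne, h.ne_left, h.ne_right, ?_, ?_⟩, ?_⟩,
    h.far, by omega, by omega, ?_, ?_, hn⟩
  · rw [hoth u h.ne_left.symm h.ne_right.symm, h.card_eq]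
  · intro l
    by_cases h3 : l = i
    · subst h3; omega
    · by_cases h4 : l = j
      · subst h4; omega
      · rw [hoth l h3 h4]
        have := h.le l
        omega
  · omega
  · omega
  · exact h.hub.of_agree hT hagree hu hi h.ne_left h.mem
      (h.conn.mem_of_brCard_pos hT h.mem (by omega))
  · refine le_trans (Finset.card_le_card fun l hl => ?_) h.num_le
    simp only [Finset.mem_filter, Finset.mem_univ, true_and] at hl ⊢
    by_cases h3 : l = i
    · subst h3; omega
    · by_cases h4 : l = j
      · subst h4; omega
      · rwa [← hoth l h3 h4]
  · refine (brNum_le_add {i, j} fun l hl hlc => ?_).trans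
      (Nat.add_le_add h.num_max.le Finset.card_le_two)
    simp only [Finset.mem_insert, Finset.mem_singleton, not_or] at hl
    rwa [← hoth l hl.1 hl.2]

end IsConf

lemma FarFrom.brSq_iterate (hT : T.IsTree) {z : V} (hz : T.Adj x z)
    (hζ : ζ ∈ branchSet T x z) {e : ℕ} {r : Finset V} (hx : x ∈ r) (hr : FarFrom T ζ e r) :
    brSq T ((TreeDensity.ext T ζ)^[e] r) x = brSq T r x + 2 * e * brCard T r x z + e ^ 2 := by
  have h1 : ∀ l, (brCard T r x l + if l = z then e else 0) ^ 2 = brCard T r x l ^ 2 +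
      (if l = z then 2 * e * brCard T r x z + e ^ 2 else 0) := by
    intro l
    split_ifs with hl
    · subst hl; ring
    · simp
  simp only [brSq, hr.brCard_iterate hT hz hζ hx, h1, Finset.sum_add_distrib,
    Finset.sum_ite_eq', Finset.mem_univ, if_true]
  ring

namespace IsConf

variable (hS : S.IsTree) (hT : T.IsTree) (h : IsConf S T k c t M n q ζ s x u i j)
include hS hT h

omit hS in
lemma farFrom {A B : Finset V} {e : ℕ} (hAB : IsSwap T x i j (rest T s x i j) A B)
    (hsum : A.card + B.card + e = brCard T s x i + brCard T s x j) :
    FarFrom T ζ e (rest T s x i j ∪ A ∪ B) := by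
  refine farFrom_of_dist hT (hAB.conn_union hT)
    (Finset.mem_union_left _ (Finset.mem_union_left _ hAB.mem)) ?_
  have h1 := h.card_rest hT hAB
  have h2 := h.far
  have h3 := Finset.card_pos.2 ⟨x, h.mem⟩
  have h4 := h.card
  have h5 := (h.conn.isSwap hT h.mem hAB.adj_left hAB.adj_right h.ne).card_union hT
  rw [rest_union_parts, h.card, ← brCard_of_adj hAB.adj_left,
    ← brCard_of_adj hAB.adj_right] at h5
  omega

lemma not_copy_of_sq (ht : 2 ≤ t) (hc : t ≤ c) {A B : Finset V} {e : ℕ}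
    (hAB : IsSwap T x i j (rest T s x i j) A B)
    (hsum : A.card + B.card + e = brCard T s x i + brCard T s x j)
    {z : V} (hz : T.Adj x z) (hζ : ζ ∈ branchSet T x z) (hzu : z ≠ u ∨ e = 0)
    (hsq : A.card ^ 2 + B.card ^ 2 + 2 * e * brCard T (rest T s x i j ∪ A ∪ B) x z + e ^ 2 ≠
      brCard T s x i ^ 2 + brCard T s x j ^ 2) :
    ¬ ∃ ψ, IsCopy S T ((ext T ζ)^[e] (rest T s x i j ∪ A ∪ B)) ψ := by
  obtain ⟨φ, hφ⟩ := h.copy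
  have hfar := h.farFrom hT hAB hsum
  have hmem : x ∈ rest T s x i j ∪ A ∪ B :=
    Finset.mem_union_left _ (Finset.mem_union_left _ hAB.mem)
  obtain ⟨h1, h2, h3⟩ := hfar.iterate_spec hT hz hζ hmem
  have h4 := hfar.brSq_iterate hT hz hζ hmem
  have h5 := h.brSq_rest hT hAB
  have h6 := h.card_rest hT hAB
  have hu := (h.adj hT ht hc).1
  refine not_isCopy_of_brSq_ne hS hT hφ (x := x) (i := u) (c := c) (q := q) ?_ (h1 hmem) h.mem
    ?_ h.card_eq h.le h.sq ?_
  · intro w hw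
    rw [← h.mem_rest_iff hT hAB hu w hw]
    refine ⟨fun hw' => ?_, fun hw' => h1 hw'⟩
    rcases hzu with hzu | rfl
    · by_contra hw''
      exact hzu (branchSet_inj hT.2 hz hu (h3 w hw' hw'') hw)
    · exact hw'
  · rw [h2, h.card]
    omega
  · rw [h4]
    intro h7
    apply hsq
    omega

omit h in
lemma _root_.TreeDensity.not_copy_of_brCard {r : Finset V} {d : ℕ} (hd : 0 < d)
    (hS' : ∀ v v', brCard S Finset.univ v v' ≠ d) (hx : x ∈ r) (hr : brCard T r x u = d) :
    ¬ ∃ ψ, IsCopy S T r ψ := by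
  rintro ⟨ψ, hψ⟩
  obtain ⟨v, rfl⟩ := (hψ.mem _).1 hx
  obtain ⟨v', rfl⟩ := (hψ.mem _).1 ((hψ.conn hS).mem_of_brCard_pos hT hx (hr ▸ hd))
  exact hS' v v' (by rw [← hψ.brCard_eq hS hT, hr])

end IsConf

end Conf

section Special

variable {V W : Type*} [Fintype V] [Fintype W]

lemma exists_of_lt_brNum {G : SimpleGraph V} {r : Finset V} {x : V} {P : ℕ → Prop} (F : Finset V)
    (h : F.card < brNum G r x P) : ∃ l ∉ F, P (brCard G r x l) := by
  obtain ⟨l, hl, hF⟩ := Finset.exists_mem_notMem_of_card_lt_card h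
  exact ⟨l, hF, (Finset.mem_filter.1 hl).2⟩

variable {S : SimpleGraph W} {T : SimpleGraph V} {k c t M n q : ℕ} {ζ : V} {s : Finset V}
  {x u i j : V}

lemma IsConf.not_copy_insert (hS : S.IsTree) (hT : T.IsTree)
    (h : IsConf S T k c t M n q ζ s x u i j) {vS : W} (hv : IsRoot S k c t M n vS)
    {v₃ u₃ : W} (h₃ : brCard S Finset.univ v₃ u₃ = c + 2)
    {r : Finset V} {p : V} (hr : Conn T r) (hx : x ∈ r) (hp : p ∉ r)
    (hcard : (insert p r).card = k)
    (hagree : ∀ w ∈ branchSet T x u, w ∈ r ↔ w ∈ s)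
    (hu' : brCard T (insert p r) x u = c + 1) (hle : ∀ l, l ≠ u → brCard T (insert p r) x l ≤ c)
    (hi' : 1 ≤ brCard T (insert p r) x i) (hj' : 1 ≤ brCard T (insert p r) x j) :
    ¬ ∃ φ, IsCopy S T (insert p r) φ := by
  rintro ⟨φ, hφ⟩
  set s₁ := insert p r with hs₁
  have hc2 := hv.two_le
  have hc3 := hv.le_max
  have hc5 := hv.max_add_le
  have hconn := hφ.conn hS
  have hxs : x ∈ s₁ := Finset.mem_insert_of_mem hx
  -- the three vertices
  obtain ⟨uC, -, huC⟩ := exists_of_lt_brNum (G := S) (r := Finset.univ) (x := vS) (P := (· = c)) ∅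
    (by rw [hv.num_max]; exact hv.pos)
  set y := φ vS with hy
  set a := φ uC with ha
  have hya : brCard T s₁ y a = c := by rw [hφ.brCard_eq hS hT, huC]
  have hyle : ∀ l, brCard T s₁ y l ≤ c := (hφ.brCard_le_iff hS hT vS c).2 hv.le
  have hys : y ∈ s₁ := hφ.apply_mem vS
  have hyhub : HubCond T k s₁ y a :=
    hφ.hubCond hS hT (adj_of_brCard_pos (s := Finset.univ) (by omega)) (hv.hub uC huC)
  have hyother : ∀ l, l ≠ a → brCard T s₁ y l + c + 3 ≤ k := by
    intro l hl
    obtain ⟨l', h1, h2⟩ := exists_of_lt_brNum (G := T) (r := s₁) (x := y) (P := (t ≤ ·)) {l, a}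
      (by
        rw [hφ.brNum_eq hS hT vS _ (by omega), hv.num]
        have := hv.three_le
        have := Finset.card_le_two (a := l) (b := a)
        omega)
    simp only [Finset.mem_insert, Finset.mem_singleton, not_or] at h1
    have := brCard_add_three_lt hT hys hl (Ne.symm h1.1) (Ne.symm h1.2)
    omega
  set y₃ := φ v₃ with hy₃
  set a₃ := φ u₃ with ha₃
  have hya₃ : brCard T s₁ y₃ a₃ = c + 2 := by rw [hφ.brCard_eq hS hT, h₃]
  have hys₃ : y₃ ∈ s₁ := hφ.apply_mem v₃
  have hyother₃ : ∀ l, l ≠ a₃ → brCard T s₁ y₃ l + c + 3 ≤ k := by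
    intro l hl
    have h1 := sum_brCard hT hys₃
    have h2 : ∑ l' ∈ ({l, a₃} : Finset V), brCard T s₁ y₃ l' ≤ ∑ l', brCard T s₁ y₃ l' :=
      Finset.sum_le_sum_of_subset (Finset.subset_univ _)
    rw [Finset.sum_pair hl] at h2
    omega
  have hxother : ∀ l, l ≠ u → brCard T s₁ x l + c + 3 ≤ k := by
    intro l hl
    by_cases hli : l = i
    · have := brCard_add_three_lt hT hxs (h.ne_left) h.ne h.ne_right.symm
      subst hli
      omega
    · have := brCard_add_three_lt hT hxs hl hli h.ne_left.symm
      omega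
  have hxu : T.Adj x u := adj_of_brCard_pos (s := s₁) (by omega)
  have hya' : T.Adj y a := adj_of_brCard_pos (s := s₁) (by omega)
  have hya₃' : T.Adj y₃ a₃ := adj_of_brCard_pos (s := s₁) (by omega)
  have hyx : y ≠ x := fun heq => by
    have := hyle u
    rw [heq] at this
    omega
  have hyy₃ : y ≠ y₃ := fun heq => by
    have := hyle a₃
    rw [heq] at this
    omega
  have hxy₃ : x ≠ y₃ := fun heq => by
    by_cases hau : a₃ = u
    · rw [hau, ← heq] at hya₃; omega
    · have := hle a₃ hau
      rw [← heq] at hya₃; omega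
  have m1 := mutual_of_bounds (r := s₁) hT hyx hya' hxu
    (fun i' hi' => by have := hyother i' hi'; omega)
    (fun j' hj' => by have := hxother j' hj'; omega)
    (fun i' j' hi' hj' hi'' hj'' h1 h2 => by
      have h3 : y ∉ branchSet T x u := fun h3 => hj' (branchSet_inj hT.2 hj'' hxu h2 h3)
      have := brCard_lt_of_notMem (r := s₁) hi'' hxs h1 h3
      have := hyle i'
      omega)
  have m2 := mutual_of_bounds (r := s₁) hT hyy₃ hya' hya₃'
    (fun i' hi' => by have := hyother i' hi'; omega)
    (fun j' hj' => by have := hyother₃ j' hj'; omega)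
    (fun i' j' hi' hj' hi'' hj'' h1 h2 => by
      have h3 : y ∉ branchSet T y₃ a₃ := fun h3 => hj' (branchSet_inj hT.2 hj'' hya₃' h2 h3)
      have := brCard_lt_of_notMem (r := s₁) hi'' hys₃ h1 h3
      have := hyle i'
      omega)
  have m3 := mutual_of_bounds (r := s₁) hT hxy₃ hxu hya₃'
    (fun i' hi' => by have := hxother i' hi'; omega)
    (fun j' hj' => by have := hyother₃ j' hj'; omega)
    (fun i' j' hi' hj' hi'' hj'' h1 h2 => by
      have h3 : x ∉ branchSet T y₃ a₃ := fun h3 => hj' (branchSet_inj hT.2 hj'' hya₃' h2 h3)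
      have := brCard_lt_of_notMem (r := s₁) hi'' hys₃ h1 h3
      have := hle i' hi'
      omega)
  obtain ⟨m, hm, b, d, b₃, hb, hd, hb₃, hbd, hbb, hdb, hyb, hxd, hyb₃, hmy, hmx, hmy₃⟩ :=
    exists_median hT hconn hys hxs hys₃ hya' hxu hya₃' m1.1 m2.1 m1.2 m3.1 m2.2 m3.2
  have e1 := compl_le_brCard (r := s₁) hT hb hya' hyb hmy
  have e2 := compl_le_brCard (r := s₁) hT hd hxu hxd hmx
  have e3 := compl_le_brCard (r := s₁) hT hb₃ hya₃' hyb₃ hmy₃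
  have f1 := brCard_add_compl s₁ hya'
  have f2 := brCard_add_compl s₁ hxu
  have f3 := brCard_add_compl s₁ hya₃'
  have g1 := hyhub.compl_le hm hmy hb hyb
    (three_le_brNum hbd hbb hdb (by omega) (by omega) (by omega))
  have g2 := brCard_add_compl s₁ hb
  have hmp : m ≠ p := by
    rintro rfl
    have hyr : y ∈ r := (Finset.mem_insert.1 hys).resolve_left
      (by rintro heq; rw [heq] at hyb; exact not_mem_branchSet_root hyb)
    exact hbd (branchSet_inj hT.2 hb hd (hr.same_branch hp hyr hx hyb) hxd)
  have hmr : m ∈ r := (Finset.mem_insert.1 hm).resolve_left hmp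
  have hms : m ∈ s := (hagree m hmx).1 hmr
  have hx1 : x ∉ branchSet T m b := fun h1 => hbd (branchSet_inj hT.2 hb hd h1 hxd)
  have hx3 : x ∉ branchSet T m b₃ := fun h1 => hdb (branchSet_inj hT.2 hb₃ hd h1 hxd).symm
  have hins : ∀ l, brCard T s₁ m l ≤ brCard T r m l + 1 := by
    intro l
    by_cases hl : T.Adj m l
    · rw [brCard_of_adj hl, brCard_of_adj hl]
      refine (Finset.card_le_card (fun w hw => ?_)).trans (Finset.card_insert_le p _)
      rw [mem_part, hs₁, Finset.mem_insert] at hw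
      rw [Finset.mem_insert, mem_part]
      tauto
    · simp [brCard, hl]
  have k1 := hins b
  have k3 := hins b₃
  rw [brCard_eq_of_agree hagree hmx hx1] at k1
  rw [brCard_eq_of_agree hagree hmx hx3] at k3
  have hi1 := h.left
  have k2 := two_le_brCard hT hxu (adj_of_brCard_pos (s := s) (by omega)) h.ne_left h.mem
    (h.conn.mem_of_brCard_pos hT h.mem (x := x) (l := i) (by omega)) hmx hd hxd
  have l1 := h.hub.compl_le hms hmx hd hxd
    (three_le_brNum hbd hbb hdb (by omega) (by omega) (by omega))
  rw [← filter_compl_eq_of_agree hT hagree hmx hd hxd] at l1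
  have l2 := brCard_add_three_lt hT hm hbd hbb hdb
  have l3 := brCard_add_compl s₁ hd
  have l4 : (s₁.filter (· ∉ branchSet T m d)).card ≤ (r.filter (· ∉ branchSet T m d)).card + 1 := by
    refine (Finset.card_le_card (fun w hw => ?_)).trans (Finset.card_insert_le p _)
    rw [Finset.mem_filter, hs₁, Finset.mem_insert] at hw
    rw [Finset.mem_insert, Finset.mem_filter]
    tauto
  omega

end Special

/-- The possible changes of the sizes of the two exchanged branches. -/
def shifts : Finset (ℤ × ℤ) := {(1, -1), (-1, 1), (-1, 0), (0, -1), (-1, -1), (0, -2), (-2, 0)}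

section Exchange

variable {V W : Type*} [Fintype V] [Fintype W]

variable {S : SimpleGraph W} {T : SimpleGraph V} {k c t M n q : ℕ} {ζ : V} {s : Finset V}
  {x u i j : V}

lemma IsConf.exists_shift (hS : S.IsTree) (hT : T.IsTree)
    (h : IsConf S T k c t M n q ζ s x u i j) {vS : W} (hv : IsRoot S k c t M n vS) {a b : ℕ}
    (hab : a = brCard T s x i ∧ b = brCard T s x j ∨ a = brCard T s x j ∧ b = brCard T s x i)
    (hN : (rootedSets T x i b).card * (rootedSets T x j a).card ≤
      (rootedSets T x i a).card * (rootedSets T x j b).card)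
    (hpos : 0 < (rootedSets T x i a).card * (rootedSets T x j b).card) :
    ∃ δ ∈ shifts, ∃ a' b' : ℕ, (a' : ℤ) = a + δ.1 ∧ (b' : ℤ) = b + δ.2 ∧
      (rootedSets T x i a).card * (rootedSets T x j b).card ≤
        2401 * ((rootedSets T x i a').card * (rootedSets T x j b').card) ∧
      ∀ A B, IsSwap T x i j (rest T s x i j) A B → A.card = a' → B.card = b' →
        IsTarg S T k c t M n ζ (-(δ.1 + δ.2)).toNat (rest T s x i j ∪ A ∪ B) x u i j := by
  have hk := hv.max_add_le
  have ht := hv.two_le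
  have hc := hv.le_max
  have ha0 := h.left
  have hb0 := h.right
  have ha0c := h.le i
  have hb0c := h.le j
  have hsum : a + b = brCard T s x i + brCard T s x j := by omega
  have hsq : a ^ 2 + b ^ 2 = brCard T s x i ^ 2 + brCard T s x j ^ 2 := by
    rcases hab with ⟨rfl, rfl⟩ | ⟨rfl, rfl⟩ <;> ring
  have hxζ : ζ ≠ x := by
    rintro rfl
    have := h.far
    rw [dist_self] at this
    omega
  obtain ⟨z, hz, hζ⟩ := exists_mem_branchSet hT.1 hxζ
  have hij := h.ne
  have hat : t ≤ a := by omega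
  have hbt : t ≤ b := by omega
  have hac : a ≤ c := by omega
  have hbc : b ≤ c := by omega
  have build : ∀ a' b' e : ℕ, a' + b' + e = a + b → e ≤ 2 → a' ≤ c + 1 → b' ≤ c + 1 →
      t - 1 ≤ a' → t - 1 ≤ b' → (z ≠ u ∨ e = 0) →
      (a' ^ 2 + b' ^ 2 + 2 * e * (if z = i then a' else if z = j then b' else brCard T s x z) +
        e ^ 2 ≠ a ^ 2 + b ^ 2) →
      ∀ A B, IsSwap T x i j (rest T s x i j) A B → A.card = a' → B.card = b' →
        IsTarg S T k c t M n ζ e (rest T s x i j ∪ A ∪ B) x u i j := by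
    rintro _ _ e h1 h2 h3 h4 h5 h6 h7 h8 A B hAB rfl rfl
    refine h.isTarg hT ht hc hAB h2 (by omega) h3 h4 h5 h6 ?_
    refine h.not_copy_of_sq hS hT ht hc hAB (by omega) hz hζ h7 ?_
    rw [← hsq]
    convert h8 using 4
    split_ifs with h9 h10
    · rw [h9, hAB.brCard_left hT]
    · rw [h10, hAB.brCard_right hT]
    · exact h.brCard_rest hT hAB h9 h10
  set f := fun m => (rootedSets T x i m).card with hf
  set g := fun m => (rootedSets T x j m).card with hg
  have hfW : WeakLC f := rootedSets_weakLC hT x i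
  have hgW : WeakLC g := rootedSets_weakLC hT x j
  change f b * g a ≤ f a * g b at hN
  change 0 < f a * g b at hpos
  change ∃ δ ∈ shifts, ∃ a' b' : ℕ, (a' : ℤ) = a + δ.1 ∧ (b' : ℤ) = b + δ.2 ∧
      f a * g b ≤ 2401 * (f a' * g b') ∧ _
  clear_value f g
  obtain ⟨a, rfl⟩ : ∃ a₁, a = a₁ + 1 := ⟨a - 1, by omega⟩
  obtain ⟨b, rfl⟩ : ∃ b₁, b = b₁ + 1 := ⟨b - 1, by omega⟩
  rcases exchange_trichotomy hfW hgW (by omega) (by omega) hN hpos with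
    ⟨h1, h2⟩ | ⟨h1, h2⟩ | ⟨h1, h2⟩
  · refine ⟨(1, -1), by decide, a + 2, b, by push_cast; ring, by push_cast; ring, by omega,
      build _ _ 0 (by omega) (by omega) (by omega) (by omega) (by omega) (by omega) (Or.inr rfl) ?_⟩
    intro heq
    ring_nf at heq
    omega
  · refine ⟨(-1, 1), by decide, a, b + 2, by push_cast; ring, by push_cast; ring, by omega,
      build _ _ 0 (by omega) (by omega) (by omega) (by omega) (by omega) (by omega) (Or.inr rfl) ?_⟩
    intro heq
    ring_nf at heq
    omega
  have h01 : f (a + 1) * g (b + 1) ≤ 49 * (f (a + 1) * g b) := by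
    calc _ ≤ f (a + 1) * (49 * g b) := Nat.mul_le_mul_left _ h2
      _ = _ := by ring
  have h10 : f (a + 1) * g (b + 1) ≤ 49 * (f a * g (b + 1)) := by
    calc _ ≤ (49 * f a) * g (b + 1) := Nat.mul_le_mul_right _ h1
      _ = _ := by ring
  have h11 : f (a + 1) * g (b + 1) ≤ 2401 * (f a * g b) := by
    calc _ ≤ (49 * f a) * (49 * g b) := Nat.mul_le_mul h1 h2
      _ = _ := by ring
  by_cases hzi : z = i
  · have hzu : z ≠ u := hzi ▸ h.ne_left
    by_cases hba : b = a + 1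
    · subst hba
      rcases exchange_succ hgW (a := a) (by omega) h1 with h3 | h3
      · refine ⟨(-1, 1), by decide, a, a + 3, by push_cast; ring, by push_cast; ring,
          h3.trans (Nat.mul_le_mul_right _ (by norm_num)),
          build _ _ 0 (by omega) (by omega) (by omega) (by omega) (by omega) (by omega)
            (Or.inr rfl) ?_⟩
        intro heq
        ring_nf at heq
        omega
      · refine ⟨(0, -2), by decide, a + 1, a, by push_cast; ring, by push_cast; ring,
          h3.trans (Nat.mul_le_mul_right _ (by norm_num)),
          build _ _ 2 (by omega) (by omega) (by omega) (by omega) (by omega) (by omega)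
            (Or.inl hzu) ?_⟩
        rw [if_pos hzi]
        intro heq
        ring_nf at heq
        omega
    · refine ⟨(0, -1), by decide, a + 1, b, by push_cast; ring, by push_cast; ring, by omega,
        build _ _ 1 (by omega) (by omega) (by omega) (by omega) (by omega) (by omega)
          (Or.inl hzu) ?_⟩
      rw [if_pos hzi]
      intro heq
      ring_nf at heq
      omega
  by_cases hzj : z = j
  · have hzu : z ≠ u := hzj ▸ h.ne_right
    by_cases hba : a = b + 1
    · subst hba
      rcases exchange_succ hfW (a := b) (by omega) h2 with h3 | h3
      · refine ⟨(1, -1), by decide, b + 3, b, by push_cast; ring, by push_cast; ring,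
          by linarith [mul_comm (f (b + 2)) (g (b + 1)), mul_comm (f (b + 3)) (g b)],
          build _ _ 0 (by omega) (by omega) (by omega) (by omega) (by omega) (by omega)
            (Or.inr rfl) ?_⟩
        intro heq
        ring_nf at heq
        omega
      · refine ⟨(-2, 0), by decide, b, b + 1, by push_cast; ring, by push_cast; ring,
          by linarith [mul_comm (f (b + 2)) (g (b + 1)), mul_comm (f b) (g (b + 1))],
          build _ _ 2 (by omega) (by omega) (by omega) (by omega) (by omega) (by omega)
            (Or.inl hzu) ?_⟩
        rw [if_neg hzi, if_pos hzj]
        intro heq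
        ring_nf at heq
        omega
    · refine ⟨(-1, 0), by decide, a, b + 1, by push_cast; ring, by push_cast; ring, by omega,
        build _ _ 1 (by omega) (by omega) (by omega) (by omega) (by omega) (by omega)
          (Or.inl hzu) ?_⟩
      rw [if_neg hzi, if_pos hzj]
      intro heq
      ring_nf at heq
      omega
  by_cases hzu : z = u
  · subst hzu
    by_cases hex : ∃ v₃ u₃, brCard S Finset.univ v₃ u₃ = c + 2
    · obtain ⟨v₃, u₃, h₃⟩ := hex
      refine ⟨(-1, 0), by decide, a, b + 1, by push_cast; ring, by push_cast; ring, by omega, ?_⟩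
      rintro A B hAB hA hB
      refine h.isTarg hT ht hc hAB (e := 1) (by omega) (by omega) (by omega) (by omega)
        (by omega) (by omega) ?_
      have hfar := h.farFrom hT hAB (e := 1) (by omega)
      have hmem : x ∈ rest T s x i j ∪ A ∪ B :=
        Finset.mem_union_left _ (Finset.mem_union_left _ hAB.mem)
      have hbr := hfar.brCard_iterate hT hz hζ hmem
      have hcd := h.card_rest hT hAB
      have hoth : ∀ l, l ≠ i → l ≠ j → brCard T (rest T s x i j ∪ A ∪ B) x l = brCard T s x l :=
        fun l => h.brCard_rest hT hAB
      have hli := hAB.brCard_left hT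
      have hlj := hAB.brCard_right hT
      obtain ⟨p, hp1, hp2, -, -⟩ := hfar.exists_ext hT
      rw [Function.iterate_one, hp1] at hbr ⊢
      refine h.not_copy_insert hS hT hv h₃ (hAB.conn_union hT) hmem hp2 ?_
        (h.mem_rest_iff hT hAB hz) ?_ ?_ ?_ ?_
      · rw [Finset.card_insert_of_notMem hp2]
        omega
      · rw [hbr, if_pos rfl, hoth z (Ne.symm h.ne_left) (Ne.symm h.ne_right), h.card_eq]
      · intro l hl
        rw [hbr, if_neg hl]
        by_cases h3 : l = i
        · subst h3; omega
        · by_cases h4 : l = j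
          · subst h4; omega
          · rw [hoth l h3 h4]
            exact h.le l
      · rw [hbr]; omega
      · rw [hbr]; omega
    · push Not at hex
      refine ⟨(-1, -1), by decide, a, b, by push_cast; ring, by push_cast; ring, h11, ?_⟩
      rintro A B hAB hA hB
      refine h.isTarg hT ht hc hAB (e := 2) (by omega) (by omega) (by omega) (by omega)
        (by omega) (by omega) ?_
      have hfar := h.farFrom hT hAB (e := 2) (by omega)
      have hmem : x ∈ rest T s x i j ∪ A ∪ B :=
        Finset.mem_union_left _ (Finset.mem_union_left _ hAB.mem)
      refine not_copy_of_brCard hS hT (d := c + 2) (by omega) hex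
        ((hfar.iterate_spec hT hz hζ hmem).1 hmem) (u := z) ?_
      rw [hfar.brCard_iterate hT hz hζ hmem, if_pos rfl,
        h.brCard_rest hT hAB (Ne.symm h.ne_left) (Ne.symm h.ne_right), h.card_eq]
  set hb := brCard T s x z with hhb
  by_cases h3 : a + 1 ≠ hb + 1
  · refine ⟨(-1, 0), by decide, a, b + 1, by push_cast; ring, by push_cast; ring, by omega,
      build _ _ 1 (by omega) (by omega) (by omega) (by omega) (by omega) (by omega)
        (Or.inl hzu) ?_⟩
    rw [if_neg hzi, if_neg hzj]
    intro heq
    ring_nf at heq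
    omega
  by_cases h4 : b + 1 ≠ hb + 1
  · refine ⟨(0, -1), by decide, a + 1, b, by push_cast; ring, by push_cast; ring, by omega,
      build _ _ 1 (by omega) (by omega) (by omega) (by omega) (by omega) (by omega)
        (Or.inl hzu) ?_⟩
    rw [if_neg hzi, if_neg hzj]
    intro heq
    ring_nf at heq
    omega
  · refine ⟨(-1, -1), by decide, a, b, by push_cast; ring, by push_cast; ring, h11,
      build _ _ 2 (by omega) (by omega) (by omega) (by omega) (by omega) (by omega)
        (Or.inl hzu) ?_⟩
    rw [if_neg hzi, if_neg hzj]
    have h5 : a = hb := by omega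
    have h6 : b = hb := by omega
    rw [h5, h6]
    intro heq
    ring_nf at heq
    omega

end Exchange

lemma card_le_mul_card_of_fibers {α β κ : Type*} [DecidableEq κ] {f : α → κ} {g : β → κ}
    {A : Finset α} {B : Finset β} (C : ℕ)
    (h : ∀ a ∈ A, (A.filter fun a' => f a' = f a).card ≤ C * (B.filter fun b => g b = f a).card) :
    A.card ≤ C * B.card := by
  calc A.card = ∑ b ∈ A.image f, (A.filter fun a => f a = b).card :=
        Finset.card_eq_sum_card_fiberwise fun a ha => Finset.mem_image_of_mem f ha
    _ ≤ ∑ b ∈ A.image f, C * (B.filter fun b' => g b' = b).card := by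
        refine Finset.sum_le_sum fun b hb => ?_
        obtain ⟨a, ha, rfl⟩ := Finset.mem_image.1 hb
        exact h a ha
    _ = C * (B.filter fun b' => g b' ∈ A.image f).card := by
        rw [← Finset.mul_sum, Finset.sum_card_fiberwise_eq_card_filter]
    _ ≤ C * B.card := Nat.mul_le_mul_left _ (Finset.card_filter_le _ _)

section Count

variable {V W : Type*} [Fintype V] [Fintype W]

/-- All tuples satisfying `IsConf`. -/
noncomputable def confs (S : SimpleGraph W) (T : SimpleGraph V) (k c t M n q : ℕ) (ζ : V) :
    Finset (Finset V × V × V × V × V) :=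
  Finset.univ.filter fun p => IsConf S T k c t M n q ζ p.1 p.2.1 p.2.2.1 p.2.2.2.1 p.2.2.2.2

/-- All shifts together with tuples satisfying `IsTarg`. -/
noncomputable def targs (S : SimpleGraph W) (T : SimpleGraph V) (k c t M n : ℕ) (ζ : V) :
    Finset ((ℤ × ℤ) × Finset V × V × V × V × V) :=
  (shifts ×ˢ Finset.univ).filter fun p => IsTarg S T k c t M n ζ (-(p.1.1 + p.1.2)).toNat
    p.2.1 p.2.2.1 p.2.2.2.1 p.2.2.2.2.1 p.2.2.2.2.2

/-- The invariant of a tuple under exchanging parts of the branches through `i` and `j`, where the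
branch sizes are corrected by `δ`. -/
noncomputable def key (T : SimpleGraph V) (δ : ℤ × ℤ) (p : Finset V × V × V × V × V) :
    (V × V × V × V) × Finset V × ℤ × ℤ :=
  (p.2, rest T p.1 p.2.1 p.2.2.2.1 p.2.2.2.2,
    (brCard T p.1 p.2.1 p.2.2.2.1 - δ.1) + (brCard T p.1 p.2.1 p.2.2.2.2 - δ.2),
    (brCard T p.1 p.2.1 p.2.2.2.1 - δ.1) * (brCard T p.1 p.2.1 p.2.2.2.2 - δ.2))

variable {S : SimpleGraph W} {T : SimpleGraph V} {k c t M n q : ℕ} {ζ : V} {s : Finset V}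
  {x u i j : V}

lemma pair_eq_of_sum_mul {a b a' b' : ℕ} (h1 : (a : ℤ) + b = a' + b')
    (h2 : (a : ℤ) * b = a' * b') : a = a' ∧ b = b' ∨ a = b' ∧ b = a' := by
  have h3 : ((a : ℤ) - a') * (a - b') = 0 := by
    have : (b : ℤ) = a' + b' - a := by linarith
    rw [this] at h2
    linarith
  rcases mul_eq_zero.1 h3 with h4 | h4
  · left; omega
  · right; omega

lemma IsConf.card_fiber_le (hT : T.IsTree) (h : IsConf S T k c t M n q ζ s x u i j)
    (ht : 2 ≤ t) (hc : t ≤ c) {a b : ℕ}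
    (hab : a = brCard T s x i ∧ b = brCard T s x j ∨ a = brCard T s x j ∧ b = brCard T s x i) :
    ((confs S T k c t M n q ζ).filter fun p => key T 0 p = key T 0 (s, x, u, i, j)).card ≤
      (rootedSets T x i a).card * (rootedSets T x j b).card +
      (rootedSets T x i b).card * (rootedSets T x j a).card := by
  rw [← Finset.card_product, ← Finset.card_product]
  refine le_trans ?_ (Finset.card_union_le _ _)
  refine Finset.card_le_card_of_injOn (fun p => (part T p.1 x i, part T p.1 x j)) ?_ ?_
  · rintro ⟨s', x', u', i', j'⟩ hp
    rw [Finset.mem_coe, Finset.mem_filter, confs, Finset.mem_filter] at hp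
    obtain ⟨⟨-, hp⟩, hkey⟩ := hp
    simp only [key, Prod.mk.injEq, Prod.fst_zero, Prod.snd_zero, sub_zero] at hkey hp
    obtain ⟨⟨rfl, rfl, rfl, rfl⟩, h1, h2, h3⟩ := hkey
    have h4 := pair_eq_of_sum_mul h2 h3
    have h5 := hp.conn.part_mem_rootedSets hT hp.mem (hp.adj hT ht hc).2.1
    have h6 := hp.conn.part_mem_rootedSets hT hp.mem (hp.adj hT ht hc).2.2
    simp only [Finset.mem_coe, Finset.mem_union, Finset.mem_product]
    have h7 : (brCard T s' x' i' = a ∧ brCard T s' x' j' = b) ∨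
        (brCard T s' x' i' = b ∧ brCard T s' x' j' = a) := by omega
    rcases h7 with ⟨h7, h8⟩ | ⟨h7, h8⟩
    · rw [h7] at h5; rw [h8] at h6; exact Or.inl ⟨h5, h6⟩
    · rw [h7] at h5; rw [h8] at h6; exact Or.inr ⟨h5, h6⟩
  · rintro ⟨s', x', u', i', j'⟩ hp ⟨s'', x'', u'', i'', j''⟩ hp' heq
    rw [Finset.mem_coe, Finset.mem_filter] at hp hp'
    have h1 := hp.2
    have h2 := hp'.2
    simp only [key, Prod.mk.injEq] at h1 h2 heq
    obtain ⟨⟨rfl, rfl, rfl, rfl⟩, h1, -, -⟩ := h1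
    obtain ⟨⟨rfl, rfl, rfl, rfl⟩, h2, -, -⟩ := h2
    rw [← rest_union_parts (G := T) s' x'' i'' j'', ← rest_union_parts (G := T) s'' x'' i'' j'',
      heq.1, heq.2, h1, h2]

lemma IsConf.le_card_fiber (hT : T.IsTree) (h : IsConf S T k c t M n q ζ s x u i j)
    (ht : 2 ≤ t) (hc : t ≤ c) {a b : ℕ}
    (hab : a = brCard T s x i ∧ b = brCard T s x j ∨ a = brCard T s x j ∧ b = brCard T s x i)
    {δ : ℤ × ℤ} (hδ : δ ∈ shifts) {a' b' : ℕ} (ha' : (a' : ℤ) = a + δ.1) (hb' : (b' : ℤ) = b + δ.2)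
    (htarg : ∀ A B, IsSwap T x i j (rest T s x i j) A B → A.card = a' → B.card = b' →
        IsTarg S T k c t M n ζ (-(δ.1 + δ.2)).toNat (rest T s x i j ∪ A ∪ B) x u i j) :
    (rootedSets T x i a').card * (rootedSets T x j b').card ≤
      ((targs S T k c t M n ζ).filter fun p => key T p.1 p.2 = key T 0 (s, x, u, i, j)).card := by
  have hsw : ∀ A ∈ rootedSets T x i a', ∀ B ∈ rootedSets T x j b',
      A.card = a' ∧ B.card = b' ∧ IsSwap T x i j (rest T s x i j) A B := by
    intro A hA B hB
    have hA' := (mem_rootedSets.1 hA).2.2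
    have hB' := (mem_rootedSets.1 hB).2.2
    have h0 := h.isSwap hT ht hc
    exact ⟨hA', hB', { h0 with left := hA'.symm ▸ hA, right := hB'.symm ▸ hB }⟩
  rw [← Finset.card_product]
  refine Finset.card_le_card_of_injOn
    (fun p => (δ, rest T s x i j ∪ p.1 ∪ p.2, x, u, i, j)) ?_ ?_
  · rintro ⟨A, B⟩ hp
    rw [Finset.mem_coe, Finset.mem_product] at hp
    obtain ⟨hA, hB, hAB⟩ := hsw A hp.1 B hp.2
    rw [Finset.mem_coe, Finset.mem_filter, targs, Finset.mem_filter, Finset.mem_product]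
    refine ⟨⟨⟨hδ, Finset.mem_univ _⟩, htarg A B hAB hA hB⟩, ?_⟩
    simp only [key, Prod.mk.injEq, true_and, Prod.fst_zero, Prod.snd_zero, sub_zero]
    rw [hAB.rest_eq, hAB.brCard_left hT, hAB.brCard_right hT, hA, hB, ha', hb']
    refine ⟨rfl, ?_, ?_⟩ <;> rcases hab with ⟨rfl, rfl⟩ | ⟨rfl, rfl⟩ <;> ring
  · rintro ⟨A, B⟩ hp ⟨A', B'⟩ hp' heq
    rw [Finset.mem_coe, Finset.mem_product] at hp hp'
    obtain ⟨-, -, hAB⟩ := hsw A hp.1 B hp.2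
    obtain ⟨-, -, hAB'⟩ := hsw A' hp'.1 B' hp'.2
    simp only [Prod.mk.injEq, true_and, and_true] at heq
    have h1 := hAB.part_left hT
    have h2 := hAB.part_right hT
    rw [heq, hAB'.part_left hT] at h1
    rw [heq, hAB'.part_right hT] at h2
    rw [h1, h2]

lemma card_confs_le (hS : S.IsTree) (hT : T.IsTree) {vS : W} (hv : IsRoot S k c t M n vS) :
    (confs S T k c t M n q ζ).card ≤ 4802 * (targs S T k c t M n ζ).card := by
  refine card_le_mul_card_of_fibers (f := key T 0) (B := targs S T k c t M n ζ)
    (g := fun p => key T p.1 p.2) 4802 ?_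
  rintro ⟨s, x, u, i, j⟩ hp
  have h : IsConf S T k c t M n q ζ s x u i j := (Finset.mem_filter.1 hp).2
  have ht := hv.two_le
  have hc := hv.le_max
  obtain ⟨a, b, hab, hN⟩ : ∃ a b, (a = brCard T s x i ∧ b = brCard T s x j ∨
      a = brCard T s x j ∧ b = brCard T s x i) ∧
      (rootedSets T x i b).card * (rootedSets T x j a).card ≤
      (rootedSets T x i a).card * (rootedSets T x j b).card := by
    rcases le_total ((rootedSets T x i (brCard T s x j)).card *
        (rootedSets T x j (brCard T s x i)).card) ((rootedSets T x i (brCard T s x i)).card *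
        (rootedSets T x j (brCard T s x j)).card) with h1 | h1
    · exact ⟨_, _, Or.inl ⟨rfl, rfl⟩, h1⟩
    · exact ⟨_, _, Or.inr ⟨rfl, rfl⟩, h1⟩
  have h1 := h.card_fiber_le hT ht hc hab
  have hpos : 0 < (rootedSets T x i a).card * (rootedSets T x j b).card := by
    by_contra h0
    have h2 : 0 < ((confs S T k c t M n q ζ).filter fun p =>
        key T 0 p = key T 0 (s, x, u, i, j)).card :=
      Finset.card_pos.2 ⟨_, Finset.mem_filter.2 ⟨hp, rfl⟩⟩
    omega
  obtain ⟨δ, hδ, a', b', ha', hb', h2, h3⟩ := h.exists_shift hS hT hv hab hN hpos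
  have h4 := h.le_card_fiber hT ht hc hab hδ ha' hb' h3
  refine h1.trans ?_
  have h5 := Nat.mul_le_mul_left 2401 h4
  omega

/-- The `k`-vertex subtrees that are not copies of `S`. -/
noncomputable def bads (S : SimpleGraph W) (T : SimpleGraph V) (k : ℕ) : Finset (Finset V) :=
  Finset.univ.filter fun s => s.card = k ∧ Conn T s ∧ ¬ ∃ ψ, IsCopy S T s ψ

lemma card_targ_le (hT : T.IsTree) (hk : 7 ≤ k) {e : ℕ} (r : Finset V) :
    (Finset.univ.filter fun p : V × V × V × V =>
      IsTarg S T k c t M n ζ e r p.1 p.2.1 p.2.2.1 p.2.2.2).card ≤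
      ((n + 2) * ((M + 1) * (M + 1))) * 2 := by
  set N := Finset.univ.filter fun x : V => ∃ u, IsNode T k c r x u with hN
  set P := Finset.univ.filter fun p : V × V × V × V =>
      IsTarg S T k c t M n ζ e r p.1 p.2.1 p.2.2.1 p.2.2.2 with hP
  have hfib : P.card ≤ ((n + 2) * ((M + 1) * (M + 1))) * N.card := by
    refine Finset.card_le_mul_card_image_of_maps_to (f := Prod.fst) ?_ _ ?_
    · rintro ⟨x, u, i, j⟩ hp
      exact Finset.mem_filter.2 ⟨Finset.mem_univ _, u, (Finset.mem_filter.1 hp).2.node⟩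
    · intro x hx
      rcases (P.filter fun p => p.1 = x).eq_empty_or_nonempty with h0 | ⟨p₀, hp₀⟩
      · rw [h0]; exact Nat.zero_le _
      rw [Finset.mem_filter, hP, Finset.mem_filter] at hp₀
      obtain ⟨⟨-, h₀⟩, rfl⟩ := hp₀
      refine le_trans (Finset.card_le_card_of_injOn Prod.snd (t :=
        (Finset.univ.filter fun l => (fun m => m = c) (brCard T r p₀.1 l)) ×ˢ
        (Finset.univ.filter fun l => (fun m => t - 1 ≤ m) (brCard T r p₀.1 l)) ×ˢ
        (Finset.univ.filter fun l => (fun m => t - 1 ≤ m) (brCard T r p₀.1 l))) ?_ ?_) ?_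
      · rintro ⟨x, u, i, j⟩ hp
        rw [Finset.mem_coe, Finset.mem_filter, hP, Finset.mem_filter] at hp
        obtain ⟨⟨-, hp⟩, hx⟩ := hp
        simp only at hx hp
        subst hx
        simp only [Finset.coe_product, Set.mem_prod, Finset.mem_coe, Finset.mem_filter,
          Finset.mem_univ, true_and]
        exact ⟨hp.node.card_eq, hp.left, hp.right⟩
      · rintro ⟨x, p⟩ hp ⟨x', p'⟩ hp' heq
        rw [Finset.mem_coe, Finset.mem_filter] at hp hp'
        obtain ⟨-, hp⟩ := hp
        obtain ⟨-, hp'⟩ := hp'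
        simp only at hp hp' heq
        rw [hp, hp', heq]
      · rw [Finset.card_product, Finset.card_product]
        have h1 : (Finset.univ.filter fun l => (fun m => t - 1 ≤ m) (brCard T r p₀.1 l)).card ≤
            M + 1 := by
          refine le_trans (le_of_eq ?_) h₀.num_le
          unfold brNum
          congr!
        refine Nat.mul_le_mul (le_trans (le_of_eq ?_) h₀.num_max) (Nat.mul_le_mul h1 h1)
        unfold brNum
        congr!
  rcases P.eq_empty_or_nonempty with h0 | ⟨p₀, hp₀⟩
  · rw [h0]
    exact Nat.zero_le _
  · refine hfib.trans (Nat.mul_le_mul_left _ ?_)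
    have h₀ := (Finset.mem_filter.1 hp₀).2
    by_contra hlt
    obtain ⟨x, y, z, hx, hy, hz, hxy, hxz, hyz⟩ := Finset.two_lt_card_iff.1 (not_le.1 hlt)
    obtain ⟨_, hx⟩ := (Finset.mem_filter.1 hx).2
    obtain ⟨_, hy⟩ := (Finset.mem_filter.1 hy).2
    obtain ⟨_, hz⟩ := (Finset.mem_filter.1 hz).2
    exact IsNode.not_three hT hk h₀.conn (by have := h₀.card; have := h₀.le_two; omega)
      hx hy hz hxy hxz hyz

lemma card_targs_le (hT : T.IsTree) (hk : 7 ≤ k) :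
    (targs S T k c t M n ζ).card ≤
      ((n + 2) * ((M + 1) * (M + 1)) * 2) * (7 * (bads S T k).card) := by
  have h7 : 7 * (bads S T k).card = (shifts ×ˢ bads S T k).card := by
    rw [Finset.card_product]
    rfl
  have hfar : ∀ {e r x u i j}, IsTarg S T k c t M n ζ e r x u i j → FarFrom T ζ e r := by
    intro e r x u i j h
    refine farFrom_of_dist hT h.conn h.node.mem ?_
    have := h.card
    have := h.far
    omega
  rw [h7]
  refine Finset.card_le_mul_card_image_of_maps_to
    (f := fun p => (p.1, (ext T ζ)^[(-(p.1.1 + p.1.2)).toNat] p.2.1)) ?_ _ ?_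
  · rintro ⟨δ, r, x, u, i, j⟩ hp
    rw [targs, Finset.mem_filter, Finset.mem_product] at hp
    obtain ⟨⟨hδ, -⟩, h⟩ := hp
    refine Finset.mem_product.2 ⟨hδ, Finset.mem_filter.2 ⟨Finset.mem_univ _, ?_, ?_, h.not_copy⟩⟩
    · have hζ : ζ ≠ x := by
        rintro rfl
        have := h.far
        rw [dist_self] at this
        omega
      obtain ⟨z, hz, hζz⟩ := exists_mem_branchSet hT.1 hζ
      rw [((hfar h).iterate_spec hT hz hζz h.node.mem).2.1]
      exact h.card
    · exact (FarFrom.iterate hT (m := 0) ((hfar h).mono (by simp))).1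
  · rintro ⟨δ, b⟩ -
    rcases ((targs S T k c t M n ζ).filter fun p =>
      (p.1, (ext T ζ)^[(-(p.1.1 + p.1.2)).toNat] p.2.1) = (δ, b)).eq_empty_or_nonempty with
      h0 | ⟨⟨δ', r₀, p₀⟩, hp₀⟩
    · rw [h0]; exact Nat.zero_le _
    rw [Finset.mem_filter, targs, Finset.mem_filter, Prod.mk.injEq] at hp₀
    obtain ⟨⟨-, h₀⟩, hδ, rfl⟩ := hp₀
    simp only at hδ h₀
    subst hδ
    have hr : ∀ p ∈ (targs S T k c t M n ζ).filter fun p =>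
        (p.1, (ext T ζ)^[(-(p.1.1 + p.1.2)).toNat] p.2.1) =
          (δ', (ext T ζ)^[(-(δ'.1 + δ'.2)).toNat] r₀), p.1 = δ' ∧ p.2.1 = r₀ ∧
          IsTarg S T k c t M n ζ (-(δ'.1 + δ'.2)).toNat r₀ p.2.2.1 p.2.2.2.1 p.2.2.2.2.1
            p.2.2.2.2.2 := by
      rintro ⟨δ, r, p⟩ hp
      rw [Finset.mem_filter, targs, Finset.mem_filter, Prod.mk.injEq] at hp
      obtain ⟨⟨-, h⟩, hδ, heq⟩ := hp
      simp only at hδ heq h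
      subst hδ
      have := iterate_ext_injOn hT (hfar h) (hfar h₀) heq
      subst this
      exact ⟨rfl, rfl, h⟩
    refine le_trans (Finset.card_le_card_of_injOn (fun p => p.2.2) (fun p hp => ?_) ?_)
      (card_targ_le (S := S) (c := c) (t := t) (ζ := ζ) hT hk (e := (-(δ'.1 + δ'.2)).toNat) r₀)
    · simp only [Finset.coe_filter, Finset.mem_univ, true_and, Set.mem_ofPred_eq]
      exact (hr p hp).2.2
    · rintro ⟨δ, r, p⟩ hp ⟨δ₂, r₂, p₂⟩ hp' heq
      have h1 := hr _ hp
      have h2 := hr _ hp'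
      simp only at h1 h2 heq
      rw [h1.1, h1.2.1, h2.1, h2.2.1, heq]

end Count

section FarCopies

variable {V W : Type*} [Fintype V] [Fintype W]

/-- The copies of `S` in `T` in which the image of `v` is at distance at least `2 * k` from `ζ`. -/
noncomputable def farCopies (S : SimpleGraph W) (T : SimpleGraph V) (k : ℕ) (v : W) (ζ : V) :
    Finset (Finset V) :=
  Finset.univ.filter fun s => ∃ φ, IsCopy S T s φ ∧ 2 * k ≤ T.dist (φ v) ζ

variable {S : SimpleGraph W} {T : SimpleGraph V} {k c t M n : ℕ} {ζ : V} {s : Finset V} {v : W}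
  {φ : W → V}

lemma IsRoot.isConf (hv : IsRoot S k c t M n v) (hS : S.IsTree) (hT : T.IsTree)
    (hcard : Fintype.card W = k) (h : IsCopy S T s φ) (hζ : 2 * k ≤ T.dist (φ v) ζ) {u i j : V}
    (hu : brCard T s (φ v) u = c) (hi : t ≤ brCard T s (φ v) i) (hj : t ≤ brCard T s (φ v) j)
    (hiu : i ≠ u) (hju : j ≠ u) (hij : i ≠ j) :
    IsConf S T k c t M n (brSq S Finset.univ v) ζ s (φ v) u i j where
  copy := ⟨φ, h⟩
  conn := h.conn hS
  card := h.card_eq.trans hcard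
  mem := h.apply_mem v
  far := hζ
  ne_left := hiu
  ne_right := hju
  ne := hij
  card_eq := hu
  le := (h.brCard_le_iff hS hT v c).2 hv.le
  left := hi
  right := hj
  sq := h.brSq_eq hS hT v
  num_le := by
    have := hv.two_le
    rw [h.brNum_eq hS hT v _ (by omega)]
    exact hv.num_le
  num_max := by
    have := hv.two_le
    have := hv.le_max
    rw [h.brNum_eq hS hT v _ (by omega)]
    exact hv.num_max
  hub := by
    have := hv.two_le
    have := hv.le_max
    have hpos : 0 < brCard T s (φ v) u := by omega
    obtain ⟨a, rfl⟩ := (h.mem _).1 ((h.conn hS).mem_of_brCard_pos hT (h.apply_mem v) hpos)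
    refine h.hubCond hS hT ((h.adj _ _).1 (adj_of_brCard_pos hpos)) (hv.hub a ?_)
    rw [← h.brCard_eq hS hT, hu]

lemma IsRoot.le_card_confs_fiber (hv : IsRoot S k c t M n v) (hS : S.IsTree) (hT : T.IsTree)
    (hcard : Fintype.card W = k) (h : IsCopy S T s φ) (hζ : 2 * k ≤ T.dist (φ v) ζ) :
    n * ((M - 1) * (M - 2)) ≤ ((confs S T k c t M n (brSq S Finset.univ v) ζ).filter
      fun p => p.1 = s).card := by
  have h2 := hv.two_le
  have hc := hv.le_max
  set U := Finset.univ.filter fun l => brCard T s (φ v) l = c with hU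
  set L := Finset.univ.filter fun l => t ≤ brCard T s (φ v) l with hL
  have hUc : U.card = n := by
    rw [← hv.num_max, ← h.brNum_eq hS hT v _ (by omega)]
    unfold brNum
    congr!
  have hLc : L.card = M := by
    rw [← hv.num, ← h.brNum_eq hS hT v _ (by omega)]
    unfold brNum
    congr!
  have hcardU : (U.sigma fun u => (L.erase u).offDiag).card = n * ((M - 1) * (M - 2)) := by
    rw [Finset.card_sigma, Finset.sum_congr rfl (g := fun _ => (M - 1) * (M - 2)), Finset.sum_const,
      hUc, smul_eq_mul]
    intro u hu
    have : u ∈ L := by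
      rw [hL, Finset.mem_filter, (Finset.mem_filter.1 hu).2]
      exact ⟨Finset.mem_univ _, hc⟩
    rw [Finset.offDiag_card, Finset.card_erase_of_mem this, hLc, ← Nat.mul_sub_one]
    rfl
  rw [← hcardU]
  refine Finset.card_le_card_of_injOn (fun p => (s, φ v, p.1, p.2.1, p.2.2)) ?_ ?_
  · rintro ⟨u, i, j⟩ hp
    simp only [Finset.mem_coe, Finset.mem_sigma, Finset.mem_offDiag, Finset.mem_erase, hU, hL,
      Finset.mem_filter, Finset.mem_univ, true_and] at hp
    obtain ⟨hu, ⟨hiu, hi⟩, ⟨hju, hj⟩, hij⟩ := hp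
    simp only [Finset.mem_coe, Finset.mem_filter, confs, Finset.mem_univ, true_and, and_true]
    exact hv.isConf hS hT hcard h hζ hu hi hj hiu hju hij
  · rintro ⟨u, i, j⟩ - ⟨u', i', j'⟩ - heq
    simp only [Prod.mk.injEq, true_and] at heq
    obtain ⟨rfl, rfl, rfl⟩ := heq
    rfl

lemma IsRoot.card_farCopies_le (hv : IsRoot S k c t M n v) (hS : S.IsTree) (hT : T.IsTree)
    (hcard : Fintype.card W = k) :
    (farCopies S T k v ζ).card ≤ 1613472 * (bads S T k).card := by
  have h1 : (farCopies S T k v ζ).card * (n * ((M - 1) * (M - 2))) ≤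
      (confs S T k c t M n (brSq S Finset.univ v) ζ).card := by
    calc _ ≤ ∑ s ∈ farCopies S T k v ζ, ((confs S T k c t M n (brSq S Finset.univ v) ζ).filter
          fun p => p.1 = s).card := by
          rw [← smul_eq_mul]
          refine Finset.card_nsmul_le_sum _ _ _ fun s hs => ?_
          obtain ⟨φ, h, hζ⟩ := (Finset.mem_filter.1 hs).2
          refine (hv.le_card_confs_fiber hS hT hcard h hζ).trans (le_of_eq ?_)
          congr!
      _ = ((confs S T k c t M n (brSq S Finset.univ v) ζ).filter
          fun p => p.1 ∈ farCopies S T k v ζ).card := by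
          convert Finset.sum_card_fiberwise_eq_card_filter _ _ _
      _ ≤ _ := Finset.card_filter_le _ _
  have hk : 7 ≤ k := by
    have := hv.two_le
    have := hv.le_max
    have := hv.max_add_le
    omega
  have h2 := (h1.trans (card_confs_le hS hT hv)).trans
    (Nat.mul_le_mul_left _ (card_targs_le hT hk))
  obtain ⟨m, rfl⟩ := Nat.exists_eq_add_of_le hv.three_le
  obtain ⟨n, rfl⟩ := Nat.exists_eq_add_of_le hv.pos
  have h3 : (1 + n) * ((3 + m - 1) * (3 + m - 2)) = (1 + n) * ((m + 2) * (m + 1)) := by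
    congr 3 <;> omega
  rw [h3] at h2
  have h4 : (1 + n + 2) * ((3 + m + 1) * (3 + m + 1)) ≤
      24 * ((1 + n) * ((m + 2) * (m + 1))) := by
    nlinarith [Nat.zero_le (n * m), Nat.zero_le (n * (m * m))]
  refine Nat.le_of_mul_le_mul_right (c := (1 + n) * ((m + 2) * (m + 1))) (h2.trans ?_)
    (by positivity)
  calc 4802 * ((1 + n + 2) * ((3 + m + 1) * (3 + m + 1)) * 2 * (7 * (bads S T k).card))
      = 67228 * (bads S T k).card * ((1 + n + 2) * ((3 + m + 1) * (3 + m + 1))) := by ring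
    _ ≤ 67228 * (bads S T k).card * (24 * ((1 + n) * ((m + 2) * (m + 1)))) :=
        Nat.mul_le_mul_left _ h4
    _ = _ := by ring

lemma density_le_of_farCopies (hS : S.IsTree) (hT : T.IsTree) (hcard : Fintype.card W = k)
    (hrad : ∀ x, ∃ w, 4 * k ≤ T.dist x w)
    (hfar : ∀ ζ, (farCopies S T k v ζ).card ≤ 1613472 * (bads S T k).card) :
    density S T ≤ 1 - (1 / 10 : ℝ) ^ 7 := by
  set C := Finset.univ.filter fun s : Finset V => ∃ φ, IsCopy S T s φ with hC
  obtain ⟨z₀⟩ := hT.1.nonempty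
  obtain ⟨ζ, -⟩ := hrad z₀
  obtain ⟨ζ', hζ'⟩ := hrad ζ
  have h1 : C.card ≤ 3226944 * (bads S T k).card := by
    have : C ⊆ farCopies S T k v ζ ∪ farCopies S T k v ζ' := by
      intro s hs
      obtain ⟨φ, h⟩ := (Finset.mem_filter.1 hs).2
      have htri := hT.1.dist_triangle (u := ζ) (v := φ v) (w := ζ')
      rw [dist_comm (u := ζ) (v := φ v)] at htri
      rw [Finset.mem_union, farCopies, farCopies, Finset.mem_filter, Finset.mem_filter]
      rcases le_or_gt (2 * k) (T.dist (φ v) ζ) with h2 | h2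
      · exact Or.inl ⟨Finset.mem_univ _, φ, h, h2⟩
      · exact Or.inr ⟨Finset.mem_univ _, φ, h, by omega⟩
    have := (Finset.card_le_card this).trans (Finset.card_union_le _ _)
    have := hfar ζ
    have := hfar ζ'
    omega
  have h2 : embCount T S (Fintype.card W) = C.card := by
    rw [embCount, ← Set.ncard_coe_finset]
    congr 1
    ext s
    simp only [hC, Set.mem_ofPred_eq, Finset.coe_filter, Finset.mem_univ, true_and,
      nonempty_iso_iff]
    exact ⟨fun h => h.2, fun ⟨φ, h⟩ => ⟨h.card_eq, φ, h⟩⟩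
  have h3 : subtreeCount T (Fintype.card W) = C.card + (bads S T k).card := by
    rw [← Finset.card_union_of_disjoint, subtreeCount, ← Set.ncard_coe_finset]
    · congr 1
      ext s
      simp only [hC, bads, Set.mem_ofPred_eq, Finset.coe_union, Set.mem_union, Finset.coe_filter,
        Finset.mem_univ, true_and]
      constructor
      · rintro ⟨h4, h5⟩
        by_cases h6 : ∃ φ, IsCopy S T s φ
        · exact Or.inl h6
        · exact Or.inr ⟨h4.trans hcard, h5, h6⟩
      · rintro (⟨φ, h⟩ | ⟨h4, h5, -⟩)
        · exact ⟨h.card_eq, h.conn hS⟩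
        · exact ⟨h4.trans hcard.symm, h5⟩
    · rw [Finset.disjoint_left]
      intro s hs hs'
      exact (Finset.mem_filter.1 hs').2.2.2 (Finset.mem_filter.1 hs).2
  have h4 : (C.card : ℝ) ≤ 3226944 * (bads S T k).card := by exact_mod_cast h1
  rw [density, h2, h3]
  push_cast
  rcases (Nat.zero_le (C.card + (bads S T k).card)).eq_or_lt with h5 | h5
  · have : (C.card : ℝ) + (bads S T k).card = 0 := by exact_mod_cast h5.symm
    rw [this]
    norm_num
  · have : (0 : ℝ) < C.card + (bads S T k).card := by exact_mod_cast h5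
    rw [div_le_iff₀ this]
    norm_num
    linarith

end FarCopies

section Root

variable {W : Type*} [Fintype W] {S : SimpleGraph W} {v u : W}

lemma brCard_univ (h : S.Adj v u) : brCard S Finset.univ v u = (branchSet S v u).ncard := by
  rw [brCard_of_adj h, part, ← Set.ncard_coe_finset]
  congr 1
  ext w
  simp

lemma brNum_eq_ncard (S : SimpleGraph W) (s : Finset W) (v : W) (P : ℕ → Prop) :
    brNum S s v P = {u | P (brCard S s v u)}.ncard := by
  rw [brNum, ← Set.ncard_coe_finset]
  congr 1
  ext w
  simp

lemma nontrivialBranch_iff : NontrivialBranch S v u ↔ 2 ≤ brCard S Finset.univ v u := by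
  constructor
  · rintro ⟨h, hne⟩
    rw [brCard_univ h]
    by_contra hlt
    have h1 := mem_branchSet_self (G := S) h.ne
    have h2 : (branchSet S v u).ncard ≤ 1 := by omega
    rw [Set.ncard_le_one (Set.toFinite _)] at h2
    exact hne (Set.eq_singleton_iff_unique_mem.2 ⟨h1, fun w hw => h2 w hw u h1⟩)
  · intro h
    have hadj : S.Adj v u := adj_of_brCard_pos (s := Finset.univ) (by omega)
    refine ⟨hadj, fun heq => ?_⟩
    rw [brCard_univ hadj, heq, Set.ncard_singleton] at h
    omega

lemma rootsThreeNontrivial_iff :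
    RootsThreeNontrivial S v ↔ 3 ≤ brNum S Finset.univ v (2 ≤ ·) := by
  rw [RootsThreeNontrivial, brNum_eq_ncard]
  simp only [nontrivialBranch_iff]

lemma ndeg_eq_one_of_brCard (h : brCard S Finset.univ v u = 1) : S.Adj v u ∧ ndeg S u = 1 := by
  have hadj : S.Adj v u := adj_of_brCard_pos (s := Finset.univ) (by omega)
  refine ⟨hadj, ?_⟩
  have hu := mem_branchSet_self (G := S) hadj.ne
  rw [brCard_univ hadj, Set.ncard_eq_one] at h
  obtain ⟨a, ha⟩ := h
  obtain rfl : u = a := by rwa [ha] at hu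
  rw [ndeg, Set.ncard_eq_one]
  refine ⟨v, Set.eq_singleton_iff_unique_mem.2 ⟨hadj.symm, fun w hw => ?_⟩⟩
  by_contra hne
  have := mem_branchSet_of_adj hu hw hne
  rw [ha] at this
  exact S.ne_of_adj hw this.symm

lemma isFork_of_brCard (hS : S.IsTree) (h : brCard S Finset.univ v u = 2) : IsFork S v u := by
  have hadj : S.Adj v u := adj_of_brCard_pos (s := Finset.univ) (by omega)
  refine ⟨nontrivialBranch_iff.2 h.ge, fun w hw hwu => ?_⟩
  have hu := mem_branchSet_self (G := S) hadj.ne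
  rw [brCard_univ hadj] at h
  have hpair : ({u, w} : Set W) = branchSet S v u := by
    refine Set.eq_of_subset_of_ncard_le (Set.insert_subset hu (Set.singleton_subset_iff.2 hw)) ?_
      (Set.toFinite _)
    rw [h, Set.ncard_pair hwu.symm]
  have hnbr : ∀ y, S.Adj w y → y = u := by
    intro y hy
    have hyv : y ≠ v := by
      rintro rfl
      exact hwu (branchSet_inj hS.2 hy.symm hadj (mem_branchSet_self hy.ne.symm) hw)
    have := mem_branchSet_of_adj hw hy hyv
    rw [← hpair] at this
    rcases this with rfl | rfl
    · rfl
    · exact absurd rfl hy.ne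
  obtain ⟨i, hi, -⟩ := exists_mem_branchSet hS.1 hwu.symm
  obtain rfl := hnbr i hi
  rw [ndeg, Set.ncard_eq_one]
  exact ⟨i, Set.eq_singleton_iff_unique_mem.2 ⟨hi, hnbr⟩⟩

lemma center_notMem_branchSet (hS : S.IsTree) {z w j : W} (hz : IsCenter S z) (hj : S.Adj w j)
    (h : Fintype.card W < 2 * (Finset.univ.filter (· ∉ branchSet S w j)).card) :
    z ∉ branchSet S w j := by
  intro hzj
  have hne : w ≠ z := by rintro rfl; exact not_mem_branchSet_root hzj
  obtain ⟨i, hi, hwi⟩ := exists_mem_branchSet hS.1 hne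
  have h1 := hz i hi
  have h2 : (Finset.univ.filter (· ∉ branchSet S w j)).card ≤ (branchSet S z i).ncard := by
    rw [← Set.ncard_coe_finset]
    refine Set.ncard_le_ncard (fun y hy => ?_) (Set.toFinite _)
    simp only [Finset.coe_filter, Finset.mem_univ, true_and, Set.mem_ofPred_eq] at hy
    exact mem_branchSet_of_notMem hS hj hzj hwi hy
  omega

lemma hubCond_of_isHub (hS : S.IsTree) (h : IsHub S v) :
    HubCond S (Fintype.card W) Finset.univ v u := by
  intro w _ hwu j hj hvj hlt
  obtain ⟨-, z, hz, -, hpath⟩ := h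
  rw [← rootsThreeNontrivial_iff]
  refine hpath w (dist_add_of_separated hS.1 (center_notMem_branchSet hS hz hj hlt) hvj) ?_
  rintro rfl
  exact not_mem_branchSet_root hvj

lemma exists_isRoot_of_brNum (hS : S.IsTree) (h : IsHub S v) {t : ℕ} (ht : 2 ≤ t)
    (hnum : 3 ≤ brNum S Finset.univ v (t ≤ ·)) (hone : brNum S Finset.univ v (· = t - 1) ≤ 1) :
    ∃ c M n, IsRoot S (Fintype.card W) c t M n v := by
  obtain ⟨u, -, hu⟩ := Finset.exists_max_image Finset.univ (brCard S Finset.univ v) ⟨v, by simp⟩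
  obtain ⟨i, hiu, hi⟩ := exists_of_lt_brNum {u}
    (lt_of_eq_of_lt (Finset.card_singleton u) (by omega : 1 < brNum S Finset.univ v (t ≤ ·)))
  obtain ⟨j, hju, hj⟩ := exists_of_lt_brNum {u, i}
    (Finset.card_le_two.trans_lt (by omega : 2 < brNum S Finset.univ v (t ≤ ·)))
  refine ⟨brCard S Finset.univ v u, _, _, ht, hi.trans (hu i (Finset.mem_univ _)), ?_, hnum,
    fun l => hu l (Finset.mem_univ _), rfl, ?_, rfl, ?_, fun _ _ => hubCond_of_isHub hS h⟩
  · have hsum := sum_brCard hS (Finset.mem_univ v)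
    have hle := Finset.sum_le_sum_of_subset (f := brCard S Finset.univ v)
      (Finset.subset_univ {u, i, j})
    simp only [Finset.mem_insert, Finset.mem_singleton, not_or] at hiu hju
    rw [Finset.sum_insert (by simp [Ne.symm hiu, Ne.symm hju.1]),
      Finset.sum_pair (Ne.symm hju.2)] at hle
    rw [Finset.card_univ] at hsum
    omega
  · refine le_trans ?_ (Nat.add_le_add_left hone _)
    unfold brNum
    refine le_trans (Finset.card_le_card ?_) (Finset.card_union_le _ _)
    intro l
    simp only [Finset.mem_filter, Finset.mem_univ, true_and, Finset.mem_union]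
    omega
  · exact Finset.card_pos.2 ⟨u, by simp⟩

lemma exists_isRoot (hS : S.IsTree) (h : IsHub S v)
    (hcond : {u | S.Adj v u ∧ ndeg S u = 1}.ncard ≤ 1 ∨
      (3 ≤ {u | IsMajor S v u}.ncard ∧ {u | IsFork S v u}.ncard ≤ 1)) :
    ∃ c t M n, IsRoot S (Fintype.card W) c t M n v := by
  rcases hcond with h1 | ⟨h1, h2⟩
  · obtain ⟨c, M, n, hr⟩ := exists_isRoot_of_brNum hS h le_rfl (rootsThreeNontrivial_iff.1 h.1) (by
      rw [brNum_eq_ncard]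
      exact (Set.ncard_le_ncard (fun u hu => ndeg_eq_one_of_brCard hu) (Set.toFinite _)).trans h1)
    exact ⟨c, 2, M, n, hr⟩
  · obtain ⟨c, M, n, hr⟩ := exists_isRoot_of_brNum hS h (t := 3) (by norm_num) (by
      rw [brNum_eq_ncard]
      refine h1.trans (Set.ncard_le_ncard (fun u hu => ?_) (Set.toFinite _))
      have h3 := nontrivialBranch_iff.1 hu.1
      refine lt_of_le_of_ne h3 fun h4 => hu.2 (isFork_of_brCard hS h4.symm)) (by
      rw [brNum_eq_ncard]
      exact (Set.ncard_le_ncard (fun u hu => isFork_of_brCard hS hu) (Set.toFinite _)).trans h2)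
    exact ⟨c, 3, M, n, hr⟩

end Root

end TreeDensity

/-- Let k ≥ 17 and let S be a k-vertex tree with a hub vS such that
either vS is adjacent to at most one leaf, or vS is the root of at least three major
branches and at most one fork.  If T is a tree with radius at least 4k, then
d(S,T) ≤ 1 - 10^(-7). -/
theorem density_le_of_hub_major {V W : Type*} [Fintype V] [Fintype W]
    (k : ℕ) (hk : 17 ≤ k)
    (S : SimpleGraph W) (hS : S.IsTree) (hcard : Fintype.card W = k)
    (vS : W) (hhub : IsHub S vS)
    (hcond : {u | S.Adj vS u ∧ ndeg S u = 1}.ncard ≤ 1 ∨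
      (3 ≤ {u | IsMajor S vS u}.ncard ∧ {u | IsFork S vS u}.ncard ≤ 1))
    (T : SimpleGraph V) (hT : T.IsTree)
    (hrad : ∀ x : V, ∃ w : V, 4 * k ≤ T.dist x w) :
    density S T ≤ 1 - (1 / 10 : ℝ) ^ 7 := by
  obtain ⟨c, t, M, n, hr⟩ := TreeDensity.exists_isRoot hS hhub hcond
  rw [hcard] at hr
  exact TreeDensity.density_le_of_farCopies hS hT hcard hrad
    fun _ => hr.card_farCopies_le hS hT hcard
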